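/- Let S ⊆ B(H) and T ⊆ B(K) be operator systems (unital self-adjoint subspaces of the bounded operators on complex Hilbert spaces H and K), and let S ⊗ T denote their algebraic tensor product with the commuting partial product m: the domain is D = (ℂ(1⊗1)×(S⊗T)) ∪ ((S⊗T)×ℂ(1⊗1)) ∪ ((S⊗ℂ1_T)×(ℂ1_S⊗T)) ∪ ((ℂ1_S⊗T)×(S⊗ℂ1_T)), with m(s⊗1_T, 1_S⊗t) = m(1_S⊗t, s⊗1_T) = s⊗t and m trivial on scalar multiples of the unit 1_S⊗1_T. For A ∈ M_n(S⊗T) define ‖A‖_n^c := inf{ ‖a_1‖ ⋯ ‖a_N‖ : A = a_1 ⊙_m ⋯ ⊙_m a_N }, where the infimum runs over all permissible factorizations in which each factor a_i is a matrix all of whose entries lie in S⊗ℂ1_T or all of whose entries lie in ℂ1_S⊗T, and ‖a_i‖ is computed via the isometric identifications of matrices over S⊗ℂ1_T with matrices over S ⊆ B(H), respectively of matrices over ℂ1_S⊗T with matrices over T ⊆ B(K). Then the family {‖·‖_n^c} is an L∞-matrix norm on S ⊗ T: each ‖·‖_n^c is a norm, ‖αAβ‖^c ≤ ‖α‖‖β‖‖A‖^c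 for scalar matrices α, β, and ‖A ⊕ B‖^c = max(‖A‖^c, ‖B‖^c). -/

import Mathlib

set_option synthInstance.maxHeartbeats 1000000
set_option maxHeartbeats 1000000

noncomputable section

open scoped BigOperators TensorProduct

/-- A matrix over `B(E)` viewed as a bounded operator between the `ℓ²`-direct sums `E^κ → E^ι`. -/
noncomputable def opMatCLM {E : Type} [NormedAddCommGroup E] [InnerProductSpace ℂ E]
    {ι κ : Type} [Fintype ι] [Fintype κ] (A : Matrix ι κ (E →L[ℂ] E)) :
    PiLp 2 (fun _ : κ => E) →L[ℂ] PiLp 2 (fun _ : ι => E) :=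
  ((PiLp.continuousLinearEquiv 2 ℂ (fun _ : ι => E)).symm.toContinuousLinearMap) ∘L
    (ContinuousLinearMap.pi fun i => ∑ j, (A i j).comp (ContinuousLinearMap.proj j)) ∘L
    ((PiLp.continuousLinearEquiv 2 ℂ (fun _ : κ => E)).toContinuousLinearMap)

/-- The operator norm of a matrix over `B(E)`, viewed as an operator `E^κ → E^ι`. -/
noncomputable def opMatNorm {E : Type} [NormedAddCommGroup E] [InnerProductSpace ℂ E]
    {ι κ : Type} [Fintype ι] [Fintype κ] (A : Matrix ι κ (E →L[ℂ] E)) : ℝ := ‖opMatCLM A‖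

/-- The norm of a matrix over a subspace `X ⊆ B(E)`, computed in `B(E)`. -/
noncomputable def subMatNorm {E : Type} [NormedAddCommGroup E] [InnerProductSpace ℂ E]
    {X : Submodule ℂ (E →L[ℂ] E)} {ι κ : Type} [Fintype ι] [Fintype κ]
    (A : Matrix ι κ ↥X) : ℝ := opMatNorm (A.map (fun v => (v : E →L[ℂ] E)))

variable {H K : Type}
  [NormedAddCommGroup H] [InnerProductSpace ℂ H] [CompleteSpace H]
  [NormedAddCommGroup K] [InnerProductSpace ℂ K] [CompleteSpace K]

variable (S : Submodule ℂ (H →L[ℂ] H)) (T : Submodule ℂ (K →L[ℂ] K))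

/-- The subspace `S ⊗ ℂ1_T` of the algebraic tensor product, consisting of the elementary
tensors `s ⊗ 1_T`. -/
def leftSlice (t1 : ↥T) : Submodule ℂ (↥S ⊗[ℂ] ↥T) :=
  LinearMap.range ((TensorProduct.mk ℂ ↥S ↥T).flip t1)

/-- The subspace `ℂ1_S ⊗ T` of the algebraic tensor product, consisting of the elementary
tensors `1_S ⊗ t`. -/
def rightSlice (s1 : ↥S) : Submodule ℂ (↥S ⊗[ℂ] ↥T) :=
  LinearMap.range (TensorProduct.mk ℂ ↥S ↥T s1)

section SliceExtraction
open Classical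

/-- Extract `s` from an element `s ⊗ 1_T` of `S ⊗ ℂ1_T` (and `0` elsewhere). -/
noncomputable def sliceS (t1 : ↥T) (a : ↥S ⊗[ℂ] ↥T) : ↥S :=
  if h : ∃ s : ↥S, s ⊗ₜ[ℂ] t1 = a then h.choose else 0

/-- Extract `t` from an element `1_S ⊗ t` of `ℂ1_S ⊗ T` (and `0` elsewhere). -/
noncomputable def sliceT (s1 : ↥S) (a : ↥S ⊗[ℂ] ↥T) : ↥T :=
  if h : ∃ t : ↥T, s1 ⊗ₜ[ℂ] t = a then h.choose else 0

end SliceExtraction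

/-- The relation on the free algebra over `S ⊗ T` encoding the commuting partial product:
`(c•(1⊗1)) · x ~ c•x`, `x · (c•(1⊗1)) ~ c•x`, `(s⊗1)·(1⊗t) ~ s⊗t` and `(1⊗t)·(s⊗1) ~ s⊗t`. -/
def comRel (s1 : ↥S) (t1 : ↥T) :
    TensorAlgebra ℂ (↥S ⊗[ℂ] ↥T) → TensorAlgebra ℂ (↥S ⊗[ℂ] ↥T) → Prop := fun p q =>
  (∃ (c : ℂ) (x : ↥S ⊗[ℂ] ↥T),
      p = TensorAlgebra.ι ℂ (c • (s1 ⊗ₜ[ℂ] t1)) * TensorAlgebra.ι ℂ x ∧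
      q = TensorAlgebra.ι ℂ (c • x)) ∨
  (∃ (c : ℂ) (x : ↥S ⊗[ℂ] ↥T),
      p = TensorAlgebra.ι ℂ x * TensorAlgebra.ι ℂ (c • (s1 ⊗ₜ[ℂ] t1)) ∧
      q = TensorAlgebra.ι ℂ (c • x)) ∨
  (∃ (s : ↥S) (t : ↥T),
      p = TensorAlgebra.ι ℂ (s ⊗ₜ[ℂ] t1) * TensorAlgebra.ι ℂ (s1 ⊗ₜ[ℂ] t) ∧
      q = TensorAlgebra.ι ℂ (s ⊗ₜ[ℂ] t)) ∨
  (∃ (s : ↥S) (t : ↥T),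
      p = TensorAlgebra.ι ℂ (s1 ⊗ₜ[ℂ] t) * TensorAlgebra.ι ℂ (s ⊗ₜ[ℂ] t1) ∧
      q = TensorAlgebra.ι ℂ (s ⊗ₜ[ℂ] t))

/-- The quotient `F_m(S ⊗ T)` of the free algebra on `S ⊗ T` by the ideal generated by the
commuting-partial-product relations. -/
abbrev ComFreeAlg (s1 : ↥S) (t1 : ↥T) : Type _ := RingQuot (comRel S T s1 t1)

/-- The canonical map `S ⊗ T → F_m(S ⊗ T)`. -/
noncomputable def comEmb (s1 : ↥S) (t1 : ↥T) : (↥S ⊗[ℂ] ↥T) → ComFreeAlg S T s1 t1 :=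
  fun v => RingQuot.mkAlgHom ℂ (comRel S T s1 t1) (TensorAlgebra.ι ℂ v)

/-- A permissible factorization datum for the commuting tensor product: a chain of matrices
over `S ⊗ T` with compatible dimensions, each factor having all entries in `S ⊗ ℂ1_T`
(`sides i = true`) or all entries in `ℂ1_S ⊗ T` (`sides i = false`). -/
structure ComFact (s1 : ↥S) (t1 : ↥T) (n k : ℕ) where
  /-- the number of factors -/
  len : ℕ
  pos : 1 ≤ len
  /-- the sequence of dimensions -/
  dims : Fin (len + 1) → ℕ
  dim_first : dims 0 = n
  dim_last : dims (Fin.last len) = k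
  /-- the factors -/
  mats : ∀ i : Fin len, Matrix (Fin (dims i.castSucc)) (Fin (dims i.succ)) (↥S ⊗[ℂ] ↥T)
  /-- which side each factor lies on -/
  sides : Fin len → Bool
  mem : ∀ (i : Fin len) r c,
    if sides i then mats i r c ∈ leftSlice S T t1 else mats i r c ∈ rightSlice S T s1

/-- The product of the factors of a `ComFact`, computed in a semiring `R` via a map `f`. -/
noncomputable def ComFact.prodIn {s1 : ↥S} {t1 : ↥T} {n k : ℕ}
    (C : ComFact S T s1 t1 n k) {R : Type*} [Semiring R] (f : (↥S ⊗[ℂ] ↥T) → R) :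
    Matrix (Fin n) (Fin k) R :=
  Matrix.of fun i j =>
    ∑ p ∈ Finset.univ.filter
        (fun p : (∀ t : Fin (C.len + 1), Fin (C.dims t)) =>
          p 0 = Fin.cast C.dim_first.symm i ∧ p (Fin.last C.len) = Fin.cast C.dim_last.symm j),
      (List.ofFn fun t : Fin C.len => f (C.mats t (p t.castSucc) (p t.succ))).prod

/-- The cost of a `ComFact`: the product of the norms of its factors, each computed via the
isometric identification of matrices over `S ⊗ ℂ1_T` with matrices over `S ⊆ B(H)`,
respectively of matrices over `ℂ1_S ⊗ T` with matrices over `T ⊆ B(K)`. -/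
noncomputable def ComFact.cost {s1 : ↥S} {t1 : ↥T} {n k : ℕ}
    (C : ComFact S T s1 t1 n k) : ℝ :=
  ∏ i : Fin C.len,
    if C.sides i
    then subMatNorm ((C.mats i).map (sliceS S T t1))
    else subMatNorm ((C.mats i).map (sliceT S T s1))

/-- The factorization norm `‖·‖ᶜ` on matrices over the algebraic tensor product `S ⊗ T`:
the infimum of the costs of all permissible factorizations whose factors are matrices with
all entries in `S ⊗ ℂ1_T` or all entries in `ℂ1_S ⊗ T`. -/
noncomputable def comNorm (s1 : ↥S) (t1 : ↥T) {n k : ℕ}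
    (A : Matrix (Fin n) (Fin k) (↥S ⊗[ℂ] ↥T)) : ℝ :=
  sInf { r : ℝ | ∃ C : ComFact S T s1 t1 n k,
    ComFact.prodIn S T C (comEmb S T s1 t1) = A.map (comEmb S T s1 t1) ∧
    r = ComFact.cost S T C }

/-- The operator norm of a rectangular complex scalar matrix. -/
noncomputable def cOpNorm {m n : ℕ} (α : Matrix (Fin m) (Fin n) ℂ) : ℝ :=
  ‖LinearMap.toContinuousLinearMap (Matrix.toEuclideanLin α)‖

/-- Left multiplication of a matrix over a complex vector space `V` by a scalar matrix. -/
def scalarMulMat {V : Type*} [AddCommGroup V] [Module ℂ V] {k n m : ℕ}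
    (α : Matrix (Fin k) (Fin n) ℂ) (x : Matrix (Fin n) (Fin m) V) :
    Matrix (Fin k) (Fin m) V :=
  Matrix.of fun i j => ∑ r, α i r • x r j

/-- Right multiplication of a matrix over a complex vector space `V` by a scalar matrix. -/
def matMulScalar {V : Type*} [AddCommGroup V] [Module ℂ V] {n m l : ℕ}
    (x : Matrix (Fin n) (Fin m) V) (β : Matrix (Fin m) (Fin l) ℂ) :
    Matrix (Fin n) (Fin l) V :=
  Matrix.of fun i j => ∑ r, β r j • x i r

/-- The block-diagonal direct sum `x ⊕ y` of two matrices over `V`. -/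
def blockDiagSum {V : Type*} [AddCommGroup V] {n m p q : ℕ}
    (x : Matrix (Fin n) (Fin m) V) (y : Matrix (Fin p) (Fin q) V) :
    Matrix (Fin (n + p)) (Fin (m + q)) V :=
  Matrix.reindex finSumFinEquiv finSumFinEquiv (Matrix.fromBlocks x 0 0 y)

section OperatorMatrices

variable {E F : Type} [NormedAddCommGroup E] [InnerProductSpace ℂ E]
  [NormedAddCommGroup F] [InnerProductSpace ℂ F]
  {ι κ ι' κ' : Type} [Fintype ι] [Fintype κ] [Fintype ι'] [Fintype κ']

/-- A matrix over `B(E)` acts contractively between the `ℓ²`-direct sums. -/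
def IsContractive (a : Matrix ι κ (E →L[ℂ] E)) : Prop :=
  ∀ x : κ → E, ∑ i, ‖∑ j, a i j (x j)‖ ^ 2 ≤ ∑ j, ‖x j‖ ^ 2

lemma opMatCLM_apply (a : Matrix ι κ (E →L[ℂ] E)) (x : PiLp 2 (fun _ : κ => E)) (i : ι) :
    opMatCLM a x i = ∑ j, a i j (x j) := by
  simp [opMatCLM]

lemma opMatNorm_nonneg (a : Matrix ι κ (E →L[ℂ] E)) : 0 ≤ opMatNorm a :=
  (opMatCLM a).opNorm_nonneg

lemma opMatNorm_le_one_iff (a : Matrix ι κ (E →L[ℂ] E)) :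
    opMatNorm a ≤ 1 ↔ IsContractive a := by
  have key : ∀ x : PiLp 2 (fun _ : κ => E), ‖opMatCLM a x‖ ≤ 1 * ‖x‖ ↔
      ∑ i, ‖∑ j, a i j (x j)‖ ^ 2 ≤ ∑ j, ‖x j‖ ^ 2 := fun x => by
    rw [one_mul, ← sq_le_sq₀ (norm_nonneg _) (norm_nonneg _), PiLp.norm_sq_eq_of_L2,
      PiLp.norm_sq_eq_of_L2]
    simp only [opMatCLM_apply]
  rw [opMatNorm, ContinuousLinearMap.opNorm_le_iff zero_le_one]
  exact ⟨fun h x => (key (WithLp.toLp 2 x)).1 (h _), fun h x => (key x).2 (h x)⟩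

lemma opMatNorm_smul_le (c : ℂ) (a : Matrix ι κ (E →L[ℂ] E)) :
    opMatNorm (c • a) ≤ ‖c‖ * opMatNorm a := by
  have : opMatCLM (c • a) = c • opMatCLM a := by
    ext x i
    simp [opMatCLM_apply, Finset.smul_sum]
  rw [opMatNorm, this]
  exact ContinuousLinearMap.opNorm_smul_le c _

lemma opMatNorm_eq_zero_of_subsingleton [Subsingleton E] (a : Matrix ι κ (E →L[ℂ] E)) :
    opMatNorm a = 0 := by
  have : opMatCLM a = 0 := by
    ext x i
    exact Subsingleton.elim _ _
  rw [opMatNorm, this, ContinuousLinearMap.opNorm_zero]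

lemma cOpNorm_nonneg {m n : ℕ} (α : Matrix (Fin m) (Fin n) ℂ) : 0 ≤ cOpNorm α := norm_nonneg _

lemma cOpNorm_smul {m n : ℕ} (c : ℂ) (α : Matrix (Fin m) (Fin n) ℂ) :
    cOpNorm (c • α) = ‖c‖ * cOpNorm α := by
  rw [cOpNorm, cOpNorm, ← norm_smul, map_smul, map_smul]

lemma cOpNorm_le_one_iff {m n : ℕ} (α : Matrix (Fin m) (Fin n) ℂ) :
    cOpNorm α ≤ 1 ↔ ∀ x : Fin n → ℂ, ∑ i, ‖∑ j, α i j * x j‖ ^ 2 ≤ ∑ j, ‖x j‖ ^ 2 := by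
  have key : ∀ x : EuclideanSpace ℂ (Fin n),
      ‖LinearMap.toContinuousLinearMap (Matrix.toEuclideanLin α) x‖ ≤ 1 * ‖x‖ ↔
      ∑ i, ‖∑ j, α i j * x j‖ ^ 2 ≤ ∑ j, ‖x j‖ ^ 2 := fun x => by
    rw [one_mul, ← sq_le_sq₀ (norm_nonneg _) (norm_nonneg _), PiLp.norm_sq_eq_of_L2,
      PiLp.norm_sq_eq_of_L2]
    simp [Matrix.toLpLin_apply, Matrix.mulVec, dotProduct]
  rw [cOpNorm, ContinuousLinearMap.opNorm_le_iff zero_le_one]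
  exact ⟨fun h x => (key (WithLp.toLp 2 x)).1 (h _), fun h x => (key x).2 (h x)⟩

lemma sum_norm_sq_smul_le {m n : ℕ} {α : Matrix (Fin m) (Fin n) ℂ} (hα : cOpNorm α ≤ 1)
    (x : Fin n → E) : ∑ i, ‖∑ j, α i j • x j‖ ^ 2 ≤ ∑ j, ‖x j‖ ^ 2 := by
  let G : Submodule ℂ E := Submodule.span ℂ (Set.range x)
  have : FiniteDimensional ℂ G := FiniteDimensional.span_of_finite ℂ (Set.finite_range x)
  let b := stdOrthonormalBasis ℂ G
  let y : Fin n → G := fun j => ⟨x j, Submodule.subset_span ⟨j, rfl⟩⟩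
  have h1 : ∀ i, ‖∑ j, α i j • x j‖ = ‖∑ j, α i j • y j‖ := fun i => by
    have : ((∑ j, α i j • y j : G) : E) = ∑ j, α i j • x j := by
      rw [AddSubmonoidClass.coe_finsetSum]; rfl
    rw [← this]; rfl
  have h2 : ∀ j, ‖x j‖ = ‖y j‖ := fun j => rfl
  simp_rw [h1, h2, ← b.sum_sq_norm_inner_right]
  rw [Finset.sum_comm, Finset.sum_comm (s := Finset.univ (α := Fin n))]
  refine Finset.sum_le_sum fun l _ => ?_
  simpa [inner_sum, inner_smul_right] using (cOpNorm_le_one_iff α).1 hα fun j => inner ℂ (b l) (y j)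

lemma norm_sq_sum_tmul {l : Type} [Fintype l] {f : l → F} (hf : Orthonormal ℂ f) (x : l → E) :
    ‖∑ k, x k ⊗ₜ[ℂ] f k‖ ^ 2 = ∑ k, ‖x k‖ ^ 2 := by
  classical
  have : (inner ℂ (∑ k, x k ⊗ₜ[ℂ] f k) (∑ k, x k ⊗ₜ[ℂ] f k) : ℂ) = ∑ k, (‖x k‖ : ℂ) ^ 2 := by
    simp [inner_sum, sum_inner, orthonormal_iff_ite.1 hf, inner_self_eq_norm_sq_to_K]
  rw [norm_sq_eq_re_inner (𝕜 := ℂ)]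
  refine (congrArg Complex.re this).trans ?_
  norm_cast

lemma exists_orthonormal_expansion (u : κ → E ⊗[ℂ] F) :
    ∃ (d : ℕ) (f : Fin d → F) (x : κ → Fin d → E), Orthonormal ℂ f ∧
      ∀ j, u j = ∑ k, x j k ⊗ₜ[ℂ] f k := by
  obtain ⟨G, hG, hu⟩ := TensorProduct.exists_finite_submodule_right_of_setFinite (Set.range u)
    (Set.finite_range u)
  let b := stdOrthonormalBasis ℂ G
  have : ∀ j, ∃ x : Fin _ → E, u j = ∑ k, x k ⊗ₜ[ℂ] (b k : F) := fun j => by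
    obtain ⟨v, hv⟩ := hu ⟨j, rfl⟩
    obtain ⟨x, rfl⟩ := TensorProduct.eq_repr_basis_right b.toBasis v
    refine ⟨x, ?_⟩
    rw [← hv, Finsupp.sum_fintype _ _ (by simp), map_sum]
    simp
  choose x hx using this
  exact ⟨_, fun k => b k, x, b.orthonormal.comp_linearIsometry G.subtypeₗᵢ, hx⟩

lemma IsContractive.rTensor {a : Matrix ι κ (E →L[ℂ] E)} (ha : IsContractive a)
    (u : κ → E ⊗[ℂ] F) :
    ∑ i, ‖∑ j, LinearMap.rTensor F (a i j).toLinearMap (u j)‖ ^ 2 ≤ ∑ j, ‖u j‖ ^ 2 := by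
  obtain ⟨d, f, x, hf, hx⟩ := exists_orthonormal_expansion u
  have h : ∀ i, ∑ j, LinearMap.rTensor F (a i j).toLinearMap (u j) =
      ∑ k, (∑ j, a i j (x j k)) ⊗ₜ[ℂ] f k := fun i => by
    simp_rw [hx, map_sum, TensorProduct.sum_tmul]
    rw [Finset.sum_comm]
    rfl
  simp_rw [h, hx, norm_sq_sum_tmul hf]
  rw [Finset.sum_comm, Finset.sum_comm (s := Finset.univ (α := κ))]
  exact Finset.sum_le_sum fun k _ => ha fun j => x j k

lemma IsContractive.lTensor {a : Matrix ι κ (F →L[ℂ] F)} (ha : IsContractive a)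
    (u : κ → E ⊗[ℂ] F) :
    ∑ i, ‖∑ j, LinearMap.lTensor E (a i j).toLinearMap (u j)‖ ^ 2 ≤ ∑ j, ‖u j‖ ^ 2 := by
  have h := ha.rTensor fun j => TensorProduct.comm ℂ E F (u j)
  simp_rw [← LinearMap.comm_comp_lTensor_comp_comm_eq] at h
  simpa [← map_sum] using h

lemma IsContractive.fromBlocks {n m p q : ℕ} {a : Matrix (Fin n) (Fin m) (E →L[ℂ] E)}
    {b : Matrix (Fin p) (Fin q) (E →L[ℂ] E)} (ha : IsContractive a) (hb : IsContractive b) :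
    IsContractive (blockDiagSum a b) := by
  intro x
  simp only [blockDiagSum, Fin.sum_univ_add]
  simpa using add_le_add (ha fun j => x (Fin.castAdd q j)) (hb fun j => x (Fin.natAdd m j))

end OperatorMatrices

section PathProducts

variable {R : Type*} [Semiring R]

/-- The entries of the product of a chain of matrices, written as sums over paths of indices. -/
def pathProd {l : ℕ} (dims : Fin (l + 1) → ℕ)
    (M : ∀ t : Fin l, Fin (dims t.castSucc) → Fin (dims t.succ) → R)
    (i : Fin (dims 0)) (j : Fin (dims (Fin.last l))) : R :=
  ∑ p ∈ Finset.univ.filter (fun p : (∀ t : Fin (l + 1), Fin (dims t)) =>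
      p 0 = i ∧ p (Fin.last l) = j),
    (List.ofFn fun t : Fin l => M t (p t.castSucc) (p t.succ)).prod

lemma pathProd_zero (dims : Fin 1 → ℕ)
    (M : ∀ t : Fin 0, Fin (dims t.castSucc) → Fin (dims t.succ) → R)
    (i j : Fin (dims 0)) : pathProd dims M i j = if i = j then 1 else 0 := by
  have h : pathProd dims M i j = ∑ x : Fin (dims 0), if x = i ∧ x = j then 1 else 0 := by
    rw [pathProd, Finset.sum_filter]
    refine ((Equiv.piUnique fun t : Fin 1 => Fin (dims t)).symm.sum_comp _).symm.trans ?_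
    exact Finset.sum_congr rfl fun x _ => rfl
  simp [h, ite_and]

lemma pathProd_succ {l : ℕ} (dims : Fin (l + 2) → ℕ)
    (M : ∀ t : Fin (l + 1), Fin (dims t.castSucc) → Fin (dims t.succ) → R)
    (i : Fin (dims 0)) (j : Fin (dims (Fin.last (l + 1)))) :
    pathProd dims M i j = ∑ k : Fin (dims (Fin.succ 0)), M 0 i k *
      pathProd (fun t => dims t.succ) (fun t => M t.succ) k j := by
  have h : pathProd dims M i j = ∑ x : Fin (dims 0), ∑ q : (∀ t : Fin (l + 1), Fin (dims t.succ)),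
      if x = i ∧ q (Fin.last l) = j then M 0 x (q 0) *
        (List.ofFn fun t : Fin l => M t.succ (q t.castSucc) (q t.succ)).prod else 0 := by
    rw [pathProd, Finset.sum_filter]
    refine ((Fin.consEquiv fun t : Fin (l + 2) => Fin (dims t)).sum_comp _).symm.trans ?_
    rw [Fintype.sum_prod_type]
    refine Finset.sum_congr rfl fun x _ => Finset.sum_congr rfl fun q _ => ?_
    rw [List.ofFn_succ, List.prod_cons]
    rfl
  rw [h]
  simp only [pathProd, Finset.sum_filter, Finset.mul_sum, ite_and]
  rw [Finset.sum_comm, Finset.sum_comm (s := Finset.univ (α := Fin (dims (Fin.succ 0))))]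
  refine Finset.sum_congr rfl fun q _ => ?_
  refine Eq.trans ?_ (Finset.sum_eq_single (q 0) (fun x _ hx => ?_)
    fun h => absurd (Finset.mem_univ _) h).symm
  · rw [if_pos rfl, mul_ite, mul_zero]
    simp
  · rw [if_neg hx.symm, mul_zero]

end PathProducts

set_option linter.unusedSectionVars false

section Factorizations

variable (s1 : ↥S) (t1 : ↥T)

/-- `comEmb` as a linear map. -/
def comEmbLin : (↥S ⊗[ℂ] ↥T) →ₗ[ℂ] ComFreeAlg S T s1 t1 :=
  (RingQuot.mkAlgHom ℂ (comRel S T s1 t1)).toLinearMap ∘ₗ TensorAlgebra.ι ℂ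

lemma comEmb_unit_mul (c : ℂ) (x : ↥S ⊗[ℂ] ↥T) :
    comEmb S T s1 t1 (c • (s1 ⊗ₜ[ℂ] t1)) * comEmb S T s1 t1 x = comEmb S T s1 t1 (c • x) := by
  refine (map_mul (RingQuot.mkAlgHom ℂ (comRel S T s1 t1)) _ _).symm.trans ?_
  exact RingQuot.mkAlgHom_rel ℂ (Or.inl ⟨c, x, rfl, rfl⟩)

lemma comEmb_mul_unit (c : ℂ) (x : ↥S ⊗[ℂ] ↥T) :
    comEmb S T s1 t1 x * comEmb S T s1 t1 (c • (s1 ⊗ₜ[ℂ] t1)) = comEmb S T s1 t1 (c • x) := by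
  refine (map_mul (RingQuot.mkAlgHom ℂ (comRel S T s1 t1)) _ _).symm.trans ?_
  exact RingQuot.mkAlgHom_rel ℂ (Or.inr (Or.inl ⟨c, x, rfl, rfl⟩))

lemma comEmb_left_mul_right (s : ↥S) (t : ↥T) :
    comEmb S T s1 t1 (s ⊗ₜ[ℂ] t1) * comEmb S T s1 t1 (s1 ⊗ₜ[ℂ] t) =
      comEmb S T s1 t1 (s ⊗ₜ[ℂ] t) := by
  refine (map_mul (RingQuot.mkAlgHom ℂ (comRel S T s1 t1)) _ _).symm.trans ?_
  exact RingQuot.mkAlgHom_rel ℂ (Or.inr (Or.inr (Or.inl ⟨s, t, rfl, rfl⟩)))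

/-- All entries lie in `S ⊗ ℂ1_T` (for `true`), respectively in `ℂ1_S ⊗ T` (for `false`). -/
def OnSide (b : Bool) {n k : ℕ} (M : Matrix (Fin n) (Fin k) (↥S ⊗[ℂ] ↥T)) : Prop :=
  ∀ r c, if b then M r c ∈ leftSlice S T t1 else M r c ∈ rightSlice S T s1

/-- The norm of a matrix lying on one of the two sides. -/
def sideNorm (b : Bool) {n k : ℕ} (M : Matrix (Fin n) (Fin k) (↥S ⊗[ℂ] ↥T)) : ℝ :=
  if b then subMatNorm (M.map (sliceS S T t1)) else subMatNorm (M.map (sliceT S T s1))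

variable {S T s1 t1}

lemma sideNorm_nonneg (b : Bool) {n k : ℕ} (M : Matrix (Fin n) (Fin k) (↥S ⊗[ℂ] ↥T)) :
    0 ≤ sideNorm S T s1 t1 b M := by
  unfold sideNorm
  split_ifs <;> exact opMatNorm_nonneg _

lemma ComFact.cost_nonneg {n k : ℕ} (C : ComFact S T s1 t1 n k) : 0 ≤ C.cost S T :=
  Finset.prod_nonneg fun i _ => sideNorm_nonneg (C.sides i) (C.mats i)

lemma ComFact.exists_single {n k : ℕ} (b : Bool) {M : Matrix (Fin n) (Fin k) (↥S ⊗[ℂ] ↥T)}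
    (hM : OnSide S T s1 t1 b M) :
    ∃ C : ComFact S T s1 t1 n k,
      C.prodIn S T (comEmb S T s1 t1) = M.map (comEmb S T s1 t1) ∧
      C.cost S T = sideNorm S T s1 t1 b M := by
  refine ⟨⟨1, le_rfl, Fin.cons n fun _ => k, rfl, rfl, Fin.cases M fun i => i.elim0,
    fun _ => b, Fin.cases hM fun i => i.elim0⟩, ?_, ?_⟩
  · ext i j
    refine (pathProd_succ (l := 0) (Fin.cons n fun _ => k)
      (fun t r c => comEmb S T s1 t1 ((Fin.cases M (fun i => i.elim0) t :
        Matrix (Fin ((Fin.cons n fun _ => k : Fin 2 → ℕ) t.castSucc))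
          (Fin ((Fin.cons n fun _ => k : Fin 2 → ℕ) t.succ)) (↥S ⊗[ℂ] ↥T)) r c)) i j).trans ?_
    refine (Finset.sum_eq_single j (fun x _ hx => ?_) fun h => absurd (Finset.mem_univ _) h).trans ?_
    · exact (congrArg (comEmb S T s1 t1 (M i x) * ·)
        ((pathProd_zero (fun _ => k) _ x j).trans (if_neg hx))).trans (mul_zero _)
    · exact (congrArg (comEmb S T s1 t1 (M i j) * ·)
        ((pathProd_zero (fun _ => k) _ j j).trans (if_pos rfl))).trans (mul_one _)
  · exact Fin.prod_univ_one _

lemma ComFact.exists_cons {n m k : ℕ} (b : Bool) {M : Matrix (Fin n) (Fin m) (↥S ⊗[ℂ] ↥T)}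
    (hM : OnSide S T s1 t1 b M) (C : ComFact S T s1 t1 m k) :
    ∃ C' : ComFact S T s1 t1 n k,
      C'.prodIn S T (comEmb S T s1 t1) =
        M.map (comEmb S T s1 t1) * C.prodIn S T (comEmb S T s1 t1) ∧
      C'.cost S T = sideNorm S T s1 t1 b M * C.cost S T := by
  obtain ⟨l, pos, dims, rfl, rfl, mats, sides, mem⟩ := C
  let D : Fin (l + 2) → ℕ := Fin.cons n dims
  let Ms : ∀ t : Fin (l + 1), Matrix (Fin (D t.castSucc)) (Fin (D t.succ)) (↥S ⊗[ℂ] ↥T) :=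
    Fin.cases M mats
  refine ⟨⟨l + 1, Nat.le_add_left _ _, D, rfl, rfl, Ms, Fin.cons b sides,
    Fin.cases hM mem⟩, ?_, ?_⟩
  · ext i j
    exact pathProd_succ D (fun t r c => comEmb S T s1 t1 (Ms t r c)) i j
  · exact Fin.prod_univ_succ _

end Factorizations

section ContractiveFactorizations

variable (s1 : ↥S) (t1 : ↥T)

/-- A matrix over `S ⊗ ℂ1_T` or over `ℂ1_S ⊗ T` of norm at most one. -/
def IsFactor {n k : ℕ} (M : Matrix (Fin n) (Fin k) (↥S ⊗[ℂ] ↥T)) : Prop :=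
  (∃ a : Matrix (Fin n) (Fin k) ↥S, IsContractive (a.map fun v => (v : H →L[ℂ] H)) ∧
    M = a.map fun s => s ⊗ₜ[ℂ] t1) ∨
  (∃ a : Matrix (Fin n) (Fin k) ↥T, IsContractive (a.map fun v => (v : K →L[ℂ] K)) ∧
    M = a.map fun t => s1 ⊗ₜ[ℂ] t)

/-- The matrices over `F_m(S ⊗ T)` that are products of factors of norm at most one. -/
inductive ContrFac : ∀ {n k : ℕ}, Matrix (Fin n) (Fin k) (ComFreeAlg S T s1 t1) → Prop
  | single {n k : ℕ} {M : Matrix (Fin n) (Fin k) (↥S ⊗[ℂ] ↥T)} (hM : IsFactor S T s1 t1 M) :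
      ContrFac (M.map (comEmb S T s1 t1))
  | cons {n m k : ℕ} {M : Matrix (Fin n) (Fin m) (↥S ⊗[ℂ] ↥T)} (hM : IsFactor S T s1 t1 M)
      {X : Matrix (Fin m) (Fin k) (ComFreeAlg S T s1 t1)} (hX : ContrFac X) :
      ContrFac (M.map (comEmb S T s1 t1) * X)

variable {S T s1 t1}

lemma map_smul_comEmb {n k : ℕ} (c : ℂ) (M : Matrix (Fin n) (Fin k) (↥S ⊗[ℂ] ↥T)) :
    (c • M).map (comEmb S T s1 t1) = c • M.map (comEmb S T s1 t1) := by
  ext i j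
  exact (comEmbLin S T s1 t1).map_smul c (M i j)

lemma tmul_left_cancel {V W : Type*} [AddCommGroup V] [Module ℂ V] [AddCommGroup W] [Module ℂ W]
    {w : W} (hw : w ≠ 0) {v v' : V} (h : v ⊗ₜ[ℂ] w = v' ⊗ₜ[ℂ] w) : v = v' := by
  obtain ⟨φ, hφ⟩ := Module.Projective.exists_dual_eq_one ℂ hw
  simpa [hφ] using congrArg (TensorProduct.rid ℂ V ∘ LinearMap.lTensor V φ) h

lemma sliceS_tmul (ht : t1 ≠ 0) (s : ↥S) : sliceS S T t1 (s ⊗ₜ[ℂ] t1) = s := by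
  have h : ∃ s' : ↥S, s' ⊗ₜ[ℂ] t1 = s ⊗ₜ[ℂ] t1 := ⟨s, rfl⟩
  rw [sliceS, dif_pos h]
  exact tmul_left_cancel ht h.choose_spec

lemma sliceT_tmul (hs : s1 ≠ 0) (t : ↥T) : sliceT S T s1 (s1 ⊗ₜ[ℂ] t) = t := by
  have h : ∃ t' : ↥T, s1 ⊗ₜ[ℂ] t' = s1 ⊗ₜ[ℂ] t := ⟨t, rfl⟩
  rw [sliceT, dif_pos h]
  exact tmul_left_cancel hs (by simpa using congrArg (TensorProduct.comm ℂ ↥S ↥T) h.choose_spec)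

lemma sliceS_tmul_of_mem {a : ↥S ⊗[ℂ] ↥T} (h : a ∈ leftSlice S T t1) :
    sliceS S T t1 a ⊗ₜ[ℂ] t1 = a := by
  have h : ∃ s : ↥S, s ⊗ₜ[ℂ] t1 = a := h
  rw [sliceS, dif_pos h]
  exact h.choose_spec

lemma tmul_sliceT_of_mem {a : ↥S ⊗[ℂ] ↥T} (h : a ∈ rightSlice S T s1) :
    s1 ⊗ₜ[ℂ] sliceT S T s1 a = a := by
  have h : ∃ t : ↥T, s1 ⊗ₜ[ℂ] t = a := h
  rw [sliceT, dif_pos h]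
  exact h.choose_spec

lemma isContractive_inv_smul {E : Type} [NormedAddCommGroup E] [InnerProductSpace ℂ E]
    {X : Submodule ℂ (E →L[ℂ] E)} {ι κ : Type} [Fintype ι] [Fintype κ] {a : Matrix ι κ ↥X} {r : ℝ}
    (h : subMatNorm a < r) : IsContractive (((r : ℂ)⁻¹ • a).map fun v => (v : E →L[ℂ] E)) := by
  have hr : 0 < r := (opMatNorm_nonneg _).trans_lt h
  rw [← opMatNorm_le_one_iff]
  refine (opMatNorm_smul_le (r : ℂ)⁻¹ (a.map fun v => (v : E →L[ℂ] E))).trans ?_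
  rw [norm_inv, Complex.norm_real, Real.norm_of_nonneg hr.le, inv_mul_le_one₀ hr]
  exact h.le

lemma subMatNorm_smul_le {E : Type} [NormedAddCommGroup E] [InnerProductSpace ℂ E]
    {X : Submodule ℂ (E →L[ℂ] E)} {ι κ : Type} [Fintype ι] [Fintype κ] {a : Matrix ι κ ↥X} {r : ℝ}
    (hr : 0 ≤ r) (h : IsContractive (a.map fun v => (v : E →L[ℂ] E))) :
    subMatNorm ((r : ℂ) • a) ≤ r := by
  refine (opMatNorm_smul_le (r : ℂ) (a.map fun v => (v : E →L[ℂ] E))).trans ?_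
  rw [Complex.norm_real, Real.norm_of_nonneg hr]
  exact mul_le_of_le_one_right hr ((opMatNorm_le_one_iff _).2 h)

lemma isFactor_inv_smul {n k : ℕ} {b : Bool} {M : Matrix (Fin n) (Fin k) (↥S ⊗[ℂ] ↥T)}
    (hM : OnSide S T s1 t1 b M) {r : ℝ} (h : sideNorm S T s1 t1 b M < r) :
    IsFactor S T s1 t1 ((r : ℂ)⁻¹ • M) := by
  cases b
  · refine Or.inr ⟨_, isContractive_inv_smul h, ?_⟩
    ext i j
    simp [TensorProduct.tmul_smul, tmul_sliceT_of_mem (hM i j)]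
  · refine Or.inl ⟨_, isContractive_inv_smul h, ?_⟩
    ext i j
    simp [← TensorProduct.smul_tmul', sliceS_tmul_of_mem (hM i j)]

lemma IsFactor.exists_sideNorm_le (hs : s1 ≠ 0) (ht : t1 ≠ 0) {n k : ℕ}
    {M : Matrix (Fin n) (Fin k) (↥S ⊗[ℂ] ↥T)} (hM : IsFactor S T s1 t1 M) {r : ℝ} (hr : 0 ≤ r) :
    ∃ b, OnSide S T s1 t1 b ((r : ℂ) • M) ∧ sideNorm S T s1 t1 b ((r : ℂ) • M) ≤ r := by
  rcases hM with ⟨a, ha, rfl⟩ | ⟨a, ha, rfl⟩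
  · refine ⟨true, fun i j => ⟨(r : ℂ) • a i j, rfl⟩, ?_⟩
    have : ((r : ℂ) • a.map fun s => s ⊗ₜ[ℂ] t1).map (sliceS S T t1) = (r : ℂ) • a := by
      ext1 i j
      exact sliceS_tmul ht ((r : ℂ) • a i j)
    rw [sideNorm, if_pos rfl, this]
    exact subMatNorm_smul_le hr ha
  · refine ⟨false, fun i j => ⟨(r : ℂ) • a i j, TensorProduct.tmul_smul _ _ _⟩, ?_⟩
    have : ((r : ℂ) • a.map fun t => s1 ⊗ₜ[ℂ] t).map (sliceT S T s1) = (r : ℂ) • a := by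
      ext1 i j
      exact (congrArg _ (TensorProduct.tmul_smul _ _ _).symm).trans
        (sliceT_tmul hs ((r : ℂ) • a i j))
    rw [sideNorm, if_neg (by simp), this]
    exact subMatNorm_smul_le hr ha

lemma ContrFac.exists_comFact (hs : s1 ≠ 0) (ht : t1 ≠ 0) {n k : ℕ}
    {X : Matrix (Fin n) (Fin k) (ComFreeAlg S T s1 t1)} (hX : ContrFac S T s1 t1 X) :
    ∀ {r : ℝ}, 0 ≤ r → ∃ C : ComFact S T s1 t1 n k,
      C.prodIn S T (comEmb S T s1 t1) = (r : ℂ) • X ∧ C.cost S T ≤ r := by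
  induction hX with
  | single hM =>
    intro r hr
    obtain ⟨b, hb, hbr⟩ := hM.exists_sideNorm_le hs ht hr
    obtain ⟨C, hC, hc⟩ := ComFact.exists_single b hb
    exact ⟨C, hC.trans (map_smul_comEmb _ _), hc.trans_le hbr⟩
  | cons hM hX ih =>
    intro r hr
    obtain ⟨b, hb, hbr⟩ := hM.exists_sideNorm_le hs ht hr
    obtain ⟨C, hC, hc⟩ := ih zero_le_one
    obtain ⟨C', hC', hc'⟩ := ComFact.exists_cons b hb C
    refine ⟨C', ?_, ?_⟩
    · rw [hC', hC, map_smul_comEmb, Complex.ofReal_one, one_smul, Matrix.smul_mul]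
    · rw [hc']
      exact (mul_le_mul hbr hc C.cost_nonneg hr).trans_eq (mul_one r)

lemma exists_mul_eq_of_mul_lt {a c r : ℝ} (ha : 0 ≤ a) (hc : 0 ≤ c) (h : a * c < r) :
    ∃ p q, a < p ∧ c < q ∧ p * q = r := by
  obtain ⟨p, hp, hpr⟩ : ∃ p, a < p ∧ p * c < r := by
    rcases hc.eq_or_lt with rfl | hc
    · exact ⟨a + 1, lt_add_one a, by simpa using h⟩
    · obtain ⟨p, h1, h2⟩ := exists_between ((lt_div_iff₀ hc).2 h)
      exact ⟨p, h1, (lt_div_iff₀ hc).1 h2⟩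
  have hp0 : 0 < p := ha.trans_lt hp
  exact ⟨p, r / p, hp, (lt_div_iff₀' hp0).2 hpr, mul_div_cancel₀ r hp0.ne'⟩

lemma contrFac_pathProd (l : ℕ) : ∀ (dims : Fin (l + 2) → ℕ)
    (mats : ∀ i : Fin (l + 1), Matrix (Fin (dims i.castSucc)) (Fin (dims i.succ)) (↥S ⊗[ℂ] ↥T))
    (sides : Fin (l + 1) → Bool) (_ : ∀ i, OnSide S T s1 t1 (sides i) (mats i)) (r : ℝ)
    (_ : ∏ i, sideNorm S T s1 t1 (sides i) (mats i) < r),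
    ContrFac S T s1 t1 ((r : ℂ)⁻¹ •
      Matrix.of (pathProd dims fun t i j => comEmb S T s1 t1 (mats t i j))) := by
  induction l with
  | zero =>
    intro dims mats sides hm r hr
    rw [Fin.prod_univ_one] at hr
    have h := ContrFac.single (isFactor_inv_smul (hm 0) hr)
    rw [map_smul_comEmb] at h
    refine (congrArg (fun Y => ContrFac S T s1 t1 ((r : ℂ)⁻¹ • Y)) ?_).mpr h
    refine Matrix.ext fun i j => ?_
    refine (pathProd_succ dims (fun t i j => comEmb S T s1 t1 (mats t i j)) i j).trans ?_
    refine (Finset.sum_eq_single j (fun x _ hx => ?_) fun h => absurd (Finset.mem_univ _) h).trans ?_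
    · exact (congrArg (comEmb S T s1 t1 (mats 0 i x) * ·)
        ((pathProd_zero (fun t => dims t.succ) _ x j).trans (if_neg hx))).trans (mul_zero _)
    · exact (congrArg (comEmb S T s1 t1 (mats 0 i j) * ·)
        ((pathProd_zero (fun t => dims t.succ) _ j j).trans (if_pos rfl))).trans (mul_one _)
  | succ l ih =>
    intro dims mats sides hm r hr
    rw [Fin.prod_univ_succ] at hr
    obtain ⟨p, q, hp, hq, rfl⟩ := exists_mul_eq_of_mul_lt (sideNorm_nonneg _ _)
      (Finset.prod_nonneg fun i _ => sideNorm_nonneg _ _) hr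
    have h := ContrFac.cons (isFactor_inv_smul (hm 0) hp)
      (ih (fun t => dims t.succ) (fun t => mats t.succ) (fun t => sides t.succ)
        (fun t => hm t.succ) q hq)
    rw [map_smul_comEmb, Matrix.smul_mul, Matrix.mul_smul, smul_smul, ← mul_inv,
      ← Complex.ofReal_mul] at h
    refine (congrArg (fun Y => ContrFac S T s1 t1 (((p * q : ℝ) : ℂ)⁻¹ • Y)) ?_).mpr h
    exact Matrix.ext fun i j =>
      pathProd_succ dims (fun t i j => comEmb S T s1 t1 (mats t i j)) i j

lemma ComFact.contrFac {n k : ℕ} (C : ComFact S T s1 t1 n k) {r : ℝ} (hr : C.cost S T < r) :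
    ContrFac S T s1 t1 ((r : ℂ)⁻¹ • C.prodIn S T (comEmb S T s1 t1)) := by
  obtain ⟨l, pos, dims, rfl, rfl, mats, sides, mem⟩ := C
  obtain ⟨l, rfl⟩ : ∃ l', l = l' + 1 := ⟨l - 1, by omega⟩
  exact contrFac_pathProd l dims mats sides mem r hr

lemma comNorm_nonneg {n k : ℕ} (A : Matrix (Fin n) (Fin k) (↥S ⊗[ℂ] ↥T)) :
    0 ≤ comNorm S T s1 t1 A := by
  refine Real.sInf_nonneg ?_
  rintro _ ⟨C, -, rfl⟩
  exact C.cost_nonneg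

lemma comNorm_le_cost {n k : ℕ} {A : Matrix (Fin n) (Fin k) (↥S ⊗[ℂ] ↥T)}
    {C : ComFact S T s1 t1 n k}
    (hC : C.prodIn S T (comEmb S T s1 t1) = A.map (comEmb S T s1 t1)) :
    comNorm S T s1 t1 A ≤ C.cost S T := by
  refine csInf_le ⟨0, ?_⟩ ⟨C, hC, rfl⟩
  rintro _ ⟨C, -, rfl⟩
  exact C.cost_nonneg

variable (s1 t1) in
/-- `A` is a scalar multiple, by `r > 0`, of a product of factors of norm at most one. -/
def FacLE {n k : ℕ} (A : Matrix (Fin n) (Fin k) (↥S ⊗[ℂ] ↥T)) (r : ℝ) : Prop :=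
  0 < r ∧ ContrFac S T s1 t1 (((r : ℂ)⁻¹ • A).map (comEmb S T s1 t1))

lemma FacLE.exists_comFact (hs : s1 ≠ 0) (ht : t1 ≠ 0) {n k : ℕ}
    {A : Matrix (Fin n) (Fin k) (↥S ⊗[ℂ] ↥T)} {r : ℝ} (h : FacLE s1 t1 A r) :
    ∃ C : ComFact S T s1 t1 n k,
      C.prodIn S T (comEmb S T s1 t1) = A.map (comEmb S T s1 t1) ∧ C.cost S T ≤ r := by
  obtain ⟨C, hC, hc⟩ := h.2.exists_comFact hs ht h.1.le
  refine ⟨C, ?_, hc⟩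
  rw [hC, ← map_smul_comEmb, smul_smul, mul_inv_cancel₀ (by exact_mod_cast h.1.ne'), one_smul]

lemma FacLE.comNorm_le (hs : s1 ≠ 0) (ht : t1 ≠ 0) {n k : ℕ}
    {A : Matrix (Fin n) (Fin k) (↥S ⊗[ℂ] ↥T)} {r : ℝ} (h : FacLE s1 t1 A r) :
    comNorm S T s1 t1 A ≤ r := by
  obtain ⟨C, hC, hc⟩ := h.exists_comFact hs ht
  exact (comNorm_le_cost hC).trans hc

lemma facLE_of_comNorm_lt (hs : s1 ≠ 0) (ht : t1 ≠ 0) {n k : ℕ}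
    {A : Matrix (Fin n) (Fin k) (↥S ⊗[ℂ] ↥T)} (hA : ∃ r, FacLE s1 t1 A r) {r : ℝ}
    (h : comNorm S T s1 t1 A < r) : FacLE s1 t1 A r := by
  obtain ⟨r₀, h₀⟩ := hA
  obtain ⟨C₀, hC₀, -⟩ := h₀.exists_comFact hs ht
  obtain ⟨_, ⟨C, hC, rfl⟩, hr⟩ := exists_lt_of_csInf_lt (by exact ⟨_, C₀, hC₀, rfl⟩) h
  refine ⟨(comNorm_nonneg A).trans_lt h, ?_⟩
  rw [map_smul_comEmb, ← hC]
  exact C.contrFac hr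

lemma comNorm_eq_zero_of_subsingleton (h : Subsingleton H ∨ Subsingleton K) {n k : ℕ}
    (A : Matrix (Fin n) (Fin k) (↥S ⊗[ℂ] ↥T)) : comNorm S T s1 t1 A = 0 := by
  have key : ∃ b, OnSide S T s1 t1 b A ∧ sideNorm S T s1 t1 b A = 0 := by
    rcases h with h | h
    · have : Subsingleton (↥S ⊗[ℂ] ↥T) := inferInstance
      refine ⟨true, fun i j => ⟨0, Subsingleton.elim _ _⟩, opMatNorm_eq_zero_of_subsingleton _⟩
    · have : Subsingleton (↥S ⊗[ℂ] ↥T) := inferInstance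
      refine ⟨false, fun i j => ⟨0, Subsingleton.elim _ _⟩, opMatNorm_eq_zero_of_subsingleton _⟩
  obtain ⟨b, hb, h0⟩ := key
  obtain ⟨C, hC, hc⟩ := ComFact.exists_single b hb
  exact le_antisymm ((comNorm_le_cost hC).trans_eq (hc.trans h0)) (comNorm_nonneg A)

end ContractiveFactorizations

section BlockMatrices

lemma blockDiagSum_map {V W : Type*} [AddCommGroup V] [AddCommGroup W] {f : V → W} (hf : f 0 = 0)
    {n m p q : ℕ} (A : Matrix (Fin n) (Fin m) V) (B : Matrix (Fin p) (Fin q) V) :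
    (blockDiagSum A B).map f = blockDiagSum (A.map f) (B.map f) := by
  rw [blockDiagSum, blockDiagSum, Matrix.reindex_apply, Matrix.reindex_apply, ← Matrix.submatrix_map,
    Matrix.fromBlocks_map, Matrix.map_zero _ hf, Matrix.map_zero _ hf]

lemma blockDiagSum_mul {R : Type*} [Ring R] {n m k p q l : ℕ}
    (A : Matrix (Fin n) (Fin m) R) (A' : Matrix (Fin m) (Fin k) R)
    (B : Matrix (Fin p) (Fin q) R) (B' : Matrix (Fin q) (Fin l) R) :
    blockDiagSum A B * blockDiagSum A' B' = blockDiagSum (A * A') (B * B') := by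
  simp [blockDiagSum, Matrix.submatrix_mul_equiv, Matrix.fromBlocks_multiply]

/-- The block row `[P Q]`. -/
def blockRow {n m p : ℕ} (P : Matrix (Fin n) (Fin m) ℂ) (Q : Matrix (Fin n) (Fin p) ℂ) :
    Matrix (Fin n) (Fin (m + p)) ℂ :=
  Matrix.of fun i => Fin.addCases (P i) (Q i)

lemma compress_blockDiagSum {V : Type*} [AddCommGroup V] [Module ℂ V] {n m p q k l : ℕ}
    (A : Matrix (Fin n) (Fin m) V) (B : Matrix (Fin p) (Fin q) V)
    (P : Matrix (Fin k) (Fin n) ℂ) (Q : Matrix (Fin k) (Fin p) ℂ)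
    (P' : Matrix (Fin l) (Fin m) ℂ) (Q' : Matrix (Fin l) (Fin q) ℂ) :
    matMulScalar (scalarMulMat (blockRow P Q) (blockDiagSum A B)) (blockRow P' Q').transpose =
      matMulScalar (scalarMulMat P A) P'.transpose +
        matMulScalar (scalarMulMat Q B) Q'.transpose := by
  ext i j
  simp [matMulScalar, scalarMulMat, blockRow, blockDiagSum, Fin.sum_univ_add]

lemma cOpNorm_one_le (n : ℕ) : cOpNorm (1 : Matrix (Fin n) (Fin n) ℂ) ≤ 1 :=
  (cOpNorm_le_one_iff _).2 fun x => by simp [Matrix.one_apply]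

lemma cOpNorm_blockRow_one_zero_le (n p : ℕ) :
    cOpNorm (blockRow (1 : Matrix (Fin n) (Fin n) ℂ) (0 : Matrix (Fin n) (Fin p) ℂ)) ≤ 1 :=
  (cOpNorm_le_one_iff _).2 fun x => by
    simpa [blockRow, Fin.sum_univ_add, Matrix.one_apply] using
      Finset.sum_nonneg fun i _ => sq_nonneg _

lemma cOpNorm_blockRow_zero_one_le (n p : ℕ) :
    cOpNorm (blockRow (0 : Matrix (Fin p) (Fin n) ℂ) (1 : Matrix (Fin p) (Fin p) ℂ)) ≤ 1 :=
  (cOpNorm_le_one_iff _).2 fun x => by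
    simpa [blockRow, Fin.sum_univ_add, Matrix.one_apply] using
      Finset.sum_nonneg fun i _ => sq_nonneg _

lemma cOpNorm_blockRow_transpose_one_zero_le (n p : ℕ) :
    cOpNorm (blockRow (1 : Matrix (Fin n) (Fin n) ℂ) (0 : Matrix (Fin n) (Fin p) ℂ)).transpose ≤ 1 :=
  (cOpNorm_le_one_iff _).2 fun x => by
    simp [blockRow, Fin.sum_univ_add, Matrix.one_apply]

lemma cOpNorm_blockRow_transpose_zero_one_le (n p : ℕ) :
    cOpNorm (blockRow (0 : Matrix (Fin p) (Fin n) ℂ) (1 : Matrix (Fin p) (Fin p) ℂ)).transpose ≤ 1 :=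
  (cOpNorm_le_one_iff _).2 fun x => by
    simp [blockRow, Fin.sum_univ_add, Matrix.one_apply]

lemma norm_add_sq_le_of_sq_add_sq {a b : ℝ} (hab : a ^ 2 + b ^ 2 = 1) (z w : ℂ) :
    ‖(a : ℂ) * z + b * w‖ ^ 2 ≤ ‖z‖ ^ 2 + ‖w‖ ^ 2 := by
  have h1 : ‖(a : ℂ) * z + b * w‖ ≤ |a| * ‖z‖ + |b| * ‖w‖ := by
    simpa using norm_add_le ((a : ℂ) * z) (b * w)
  have h2 := pow_le_pow_left₀ (norm_nonneg _) h1 2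
  nlinarith [sq_nonneg (|a| * ‖w‖ - |b| * ‖z‖), sq_abs a, sq_abs b]

lemma cOpNorm_blockRow_smul_one_le (n : ℕ) {a b : ℝ} (hab : a ^ 2 + b ^ 2 = 1) :
    cOpNorm (blockRow ((a : ℂ) • (1 : Matrix (Fin n) (Fin n) ℂ)) ((b : ℂ) • (1 : Matrix (Fin n) (Fin n) ℂ))) ≤ 1 :=
  (cOpNorm_le_one_iff _).2 fun x => by
    simpa [blockRow, Fin.sum_univ_add, Matrix.one_apply, ← Finset.sum_add_distrib,
      -Fin.natAdd_eq_addNat] using Finset.sum_le_sum fun i _ => norm_add_sq_le_of_sq_add_sq hab _ _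

lemma cOpNorm_blockRow_transpose_smul_one_le (n : ℕ) {a b : ℝ} (hab : a ^ 2 + b ^ 2 = 1) :
    cOpNorm (blockRow ((a : ℂ) • (1 : Matrix (Fin n) (Fin n) ℂ)) ((b : ℂ) • (1 : Matrix (Fin n) (Fin n) ℂ))).transpose ≤ 1 :=
  (cOpNorm_le_one_iff _).2 fun x => by
    simp [blockRow, Fin.sum_univ_add, Matrix.one_apply, mul_pow, ← Finset.mul_sum, ← add_mul, hab,
      -Fin.natAdd_eq_addNat]

end BlockMatrices

section MatrixNorm

variable {S T} {s1 : ↥S} {t1 : ↥T}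

lemma comEmb_zero : comEmb S T s1 t1 0 = 0 := (comEmbLin S T s1 t1).map_zero

lemma ContrFac.mul {n m k : ℕ} {X : Matrix (Fin n) (Fin m) (ComFreeAlg S T s1 t1)}
    {Y : Matrix (Fin m) (Fin k) (ComFreeAlg S T s1 t1)} (hX : ContrFac S T s1 t1 X)
    (hY : ContrFac S T s1 t1 Y) : ContrFac S T s1 t1 (X * Y) := by
  induction hX with
  | single hM => exact .cons hM hY
  | cons hM _ ih =>
    rw [Matrix.mul_assoc]
    exact .cons hM (ih hY)

lemma isContractive_scalar {E : Type} [NormedAddCommGroup E] [InnerProductSpace ℂ E]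
    {X : Submodule ℂ (E →L[ℂ] E)} {u : ↥X} (hu : (u : E →L[ℂ] E) = 1) {n k : ℕ}
    {α : Matrix (Fin n) (Fin k) ℂ} (hα : cOpNorm α ≤ 1) :
    IsContractive ((α.map fun c => c • u).map fun v => (v : E →L[ℂ] E)) := fun x => by
  simpa [hu] using sum_norm_sq_smul_le hα x

variable (s1 t1) in
/-- A scalar matrix, viewed as a matrix over the multiples of the unit of `S ⊗ T`. -/
def scalarMat {n k : ℕ} (α : Matrix (Fin n) (Fin k) ℂ) : Matrix (Fin n) (Fin k) (↥S ⊗[ℂ] ↥T) :=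
  α.map fun c => c • (s1 ⊗ₜ[ℂ] t1)

lemma isFactor_scalarMat (hs : (s1 : H →L[ℂ] H) = 1) {n k : ℕ} {α : Matrix (Fin n) (Fin k) ℂ}
    (hα : cOpNorm α ≤ 1) : IsFactor S T s1 t1 (scalarMat s1 t1 α) :=
  Or.inl ⟨α.map fun c => c • s1, isContractive_scalar hs hα, rfl⟩

lemma map_scalarMulMat {n k m : ℕ} (α : Matrix (Fin k) (Fin n) ℂ)
    (A : Matrix (Fin n) (Fin m) (↥S ⊗[ℂ] ↥T)) :
    (scalarMulMat α A).map (comEmb S T s1 t1) =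
      (scalarMat s1 t1 α).map (comEmb S T s1 t1) * A.map (comEmb S T s1 t1) := by
  ext i j
  exact (map_sum (comEmbLin S T s1 t1) _ Finset.univ).trans
    (Finset.sum_congr rfl fun r _ => (comEmb_unit_mul S T s1 t1 (α i r) (A r j)).symm)

lemma map_matMulScalar {n k m : ℕ} (A : Matrix (Fin n) (Fin m) (↥S ⊗[ℂ] ↥T))
    (β : Matrix (Fin m) (Fin k) ℂ) :
    (matMulScalar A β).map (comEmb S T s1 t1) =
      A.map (comEmb S T s1 t1) * (scalarMat s1 t1 β).map (comEmb S T s1 t1) := by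
  ext i j
  exact (map_sum (comEmbLin S T s1 t1) _ Finset.univ).trans
    (Finset.sum_congr rfl fun r _ => (comEmb_mul_unit S T s1 t1 (β r j) (A i r)).symm)

lemma ContrFac.compress (hs : (s1 : H →L[ℂ] H) = 1) {n m k l : ℕ}
    {A : Matrix (Fin n) (Fin m) (↥S ⊗[ℂ] ↥T)} (hA : ContrFac S T s1 t1 (A.map (comEmb S T s1 t1)))
    {α : Matrix (Fin k) (Fin n) ℂ} {β : Matrix (Fin m) (Fin l) ℂ}
    (hα : cOpNorm α ≤ 1) (hβ : cOpNorm β ≤ 1) :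
    ContrFac S T s1 t1 ((matMulScalar (scalarMulMat α A) β).map (comEmb S T s1 t1)) := by
  rw [map_matMulScalar, map_scalarMulMat]
  exact ((ContrFac.single (isFactor_scalarMat hs hα)).mul hA).mul
    (.single (isFactor_scalarMat hs hβ))

lemma scalarMulMat_one {V : Type*} [AddCommGroup V] [Module ℂ V] {n m : ℕ}
    (A : Matrix (Fin n) (Fin m) V) : scalarMulMat 1 A = A := by
  ext i j
  simp [scalarMulMat, Matrix.one_apply]

lemma matMulScalar_one {V : Type*} [AddCommGroup V] [Module ℂ V] {n m : ℕ}
    (A : Matrix (Fin n) (Fin m) V) : matMulScalar A 1 = A := by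
  ext i j
  simp [matMulScalar, Matrix.one_apply]

lemma matMulScalar_zero {V : Type*} [AddCommGroup V] [Module ℂ V] {n m k : ℕ}
    (A : Matrix (Fin n) (Fin m) V) : matMulScalar A (0 : Matrix (Fin m) (Fin k) ℂ) = 0 := by
  ext i j
  simp [matMulScalar]

lemma scalarMulMat_smul_one {V : Type*} [AddCommGroup V] [Module ℂ V] {n m : ℕ} (c : ℂ)
    (A : Matrix (Fin n) (Fin m) V) : scalarMulMat (c • 1) A = c • A := by
  ext i j
  simp [scalarMulMat, Matrix.one_apply]

lemma matMulScalar_smul_one {V : Type*} [AddCommGroup V] [Module ℂ V] {n m : ℕ} (c : ℂ)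
    (A : Matrix (Fin n) (Fin m) V) : matMulScalar A (c • 1) = c • A := by
  ext i j
  simp [matMulScalar, Matrix.one_apply]

lemma smul_compress {V : Type*} [AddCommGroup V] [Module ℂ V] {n m k l : ℕ} (c : ℂ)
    (α : Matrix (Fin k) (Fin n) ℂ) (A : Matrix (Fin n) (Fin m) V) (β : Matrix (Fin m) (Fin l) ℂ) :
    matMulScalar (scalarMulMat α (c • A)) β = c • matMulScalar (scalarMulMat α A) β := by
  ext i j
  simp [matMulScalar, scalarMulMat, Finset.smul_sum, smul_comm c]

variable (s1 t1) in
/-- The unit matrix over `F_m(S ⊗ T)` built from the image of `1_S ⊗ 1_T`. -/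
def unitMat (p : ℕ) : Matrix (Fin p) (Fin p) (ComFreeAlg S T s1 t1) :=
  (scalarMat s1 t1 1).map (comEmb S T s1 t1)

lemma unitMat_mul_map {n m : ℕ} (A : Matrix (Fin n) (Fin m) (↥S ⊗[ℂ] ↥T)) :
    unitMat s1 t1 n * A.map (comEmb S T s1 t1) = A.map (comEmb S T s1 t1) := by
  rw [unitMat, ← map_scalarMulMat, scalarMulMat_one]

lemma map_mul_unitMat {n m : ℕ} (A : Matrix (Fin n) (Fin m) (↥S ⊗[ℂ] ↥T)) :
    A.map (comEmb S T s1 t1) * unitMat s1 t1 m = A.map (comEmb S T s1 t1) := by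
  rw [unitMat, ← map_matMulScalar, matMulScalar_one]

lemma unitMat_mul_unitMat (p : ℕ) : unitMat s1 t1 p * unitMat s1 t1 p = unitMat s1 t1 p :=
  unitMat_mul_map _

lemma IsFactor.blockDiagSum_scalarMat (hs : (s1 : H →L[ℂ] H) = 1) (ht : (t1 : K →L[ℂ] K) = 1)
    {n k : ℕ} {M : Matrix (Fin n) (Fin k) (↥S ⊗[ℂ] ↥T)} (hM : IsFactor S T s1 t1 M) (p : ℕ) :
    IsFactor S T s1 t1 (blockDiagSum M (scalarMat s1 t1 (1 : Matrix (Fin p) (Fin p) ℂ))) := by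
  rcases hM with ⟨a, ha, rfl⟩ | ⟨a, ha, rfl⟩
  · refine Or.inl ⟨blockDiagSum a ((1 : Matrix (Fin p) (Fin p) ℂ).map fun c => c • s1), ?_, ?_⟩
    · rw [blockDiagSum_map (by rfl)]
      exact ha.fromBlocks (isContractive_scalar hs (cOpNorm_one_le p))
    · rw [blockDiagSum_map (TensorProduct.zero_tmul _ _)]
      rfl
  · refine Or.inr ⟨blockDiagSum a ((1 : Matrix (Fin p) (Fin p) ℂ).map fun c => c • t1), ?_, ?_⟩
    · rw [blockDiagSum_map (by rfl)]
      exact ha.fromBlocks (isContractive_scalar ht (cOpNorm_one_le p))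
    · rw [blockDiagSum_map (TensorProduct.tmul_zero _ _)]
      congr 1
      ext i j
      exact (TensorProduct.tmul_smul _ _ _).symm

lemma IsFactor.scalarMat_blockDiagSum (hs : (s1 : H →L[ℂ] H) = 1) (ht : (t1 : K →L[ℂ] K) = 1)
    {n k : ℕ} {M : Matrix (Fin n) (Fin k) (↥S ⊗[ℂ] ↥T)} (hM : IsFactor S T s1 t1 M) (p : ℕ) :
    IsFactor S T s1 t1 (blockDiagSum (scalarMat s1 t1 (1 : Matrix (Fin p) (Fin p) ℂ)) M) := by
  rcases hM with ⟨a, ha, rfl⟩ | ⟨a, ha, rfl⟩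
  · refine Or.inl ⟨blockDiagSum ((1 : Matrix (Fin p) (Fin p) ℂ).map fun c => c • s1) a, ?_, ?_⟩
    · rw [blockDiagSum_map (by rfl)]
      exact (isContractive_scalar hs (cOpNorm_one_le p)).fromBlocks ha
    · rw [blockDiagSum_map (TensorProduct.zero_tmul _ _)]
      rfl
  · refine Or.inr ⟨blockDiagSum ((1 : Matrix (Fin p) (Fin p) ℂ).map fun c => c • t1) a, ?_, ?_⟩
    · rw [blockDiagSum_map (by rfl)]
      exact (isContractive_scalar ht (cOpNorm_one_le p)).fromBlocks ha
    · rw [blockDiagSum_map (TensorProduct.tmul_zero _ _)]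
      congr 1
      ext i j
      exact (TensorProduct.tmul_smul _ _ _).symm

lemma ContrFac.blockDiagSum_unitMat (hs : (s1 : H →L[ℂ] H) = 1) (ht : (t1 : K →L[ℂ] K) = 1)
    {n k : ℕ} {X : Matrix (Fin n) (Fin k) (ComFreeAlg S T s1 t1)} (hX : ContrFac S T s1 t1 X)
    (p : ℕ) : ContrFac S T s1 t1 (blockDiagSum X (unitMat s1 t1 p)) := by
  induction hX with
  | single hM =>
    rw [unitMat, ← blockDiagSum_map comEmb_zero]
    exact .single (hM.blockDiagSum_scalarMat hs ht p)
  | cons hM hX ih =>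
    rw [← unitMat_mul_unitMat, ← blockDiagSum_mul]
    refine ContrFac.mul ?_ ih
    rw [unitMat, ← blockDiagSum_map comEmb_zero]
    exact .single (hM.blockDiagSum_scalarMat hs ht p)

lemma ContrFac.unitMat_blockDiagSum (hs : (s1 : H →L[ℂ] H) = 1) (ht : (t1 : K →L[ℂ] K) = 1)
    {n k : ℕ} {X : Matrix (Fin n) (Fin k) (ComFreeAlg S T s1 t1)} (hX : ContrFac S T s1 t1 X)
    (p : ℕ) : ContrFac S T s1 t1 (blockDiagSum (unitMat s1 t1 p) X) := by
  induction hX with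
  | single hM =>
    rw [unitMat, ← blockDiagSum_map comEmb_zero]
    exact .single (hM.scalarMat_blockDiagSum hs ht p)
  | cons hM hX ih =>
    rw [← unitMat_mul_unitMat, ← blockDiagSum_mul]
    refine ContrFac.mul ?_ ih
    rw [unitMat, ← blockDiagSum_map comEmb_zero]
    exact .single (hM.scalarMat_blockDiagSum hs ht p)

lemma ContrFac.blockDiagSum (hs : (s1 : H →L[ℂ] H) = 1) (ht : (t1 : K →L[ℂ] K) = 1)
    {n m p q : ℕ} {A : Matrix (Fin n) (Fin m) (↥S ⊗[ℂ] ↥T)}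
    {B : Matrix (Fin p) (Fin q) (↥S ⊗[ℂ] ↥T)}
    (hA : ContrFac S T s1 t1 (A.map (comEmb S T s1 t1)))
    (hB : ContrFac S T s1 t1 (B.map (comEmb S T s1 t1))) :
    ContrFac S T s1 t1 ((blockDiagSum A B).map (comEmb S T s1 t1)) := by
  rw [blockDiagSum_map comEmb_zero, ← map_mul_unitMat A, ← unitMat_mul_map B, ← blockDiagSum_mul]
  exact (hA.blockDiagSum_unitMat hs ht p).mul (hB.unitMat_blockDiagSum hs ht m)

lemma FacLE.compress (hs : (s1 : H →L[ℂ] H) = 1) {n m k l : ℕ}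
    {A : Matrix (Fin n) (Fin m) (↥S ⊗[ℂ] ↥T)} {r : ℝ} (hA : FacLE s1 t1 A r)
    {α : Matrix (Fin k) (Fin n) ℂ} {β : Matrix (Fin m) (Fin l) ℂ}
    (hα : cOpNorm α ≤ 1) (hβ : cOpNorm β ≤ 1) :
    FacLE s1 t1 (matMulScalar (scalarMulMat α A) β) r := by
  refine ⟨hA.1, ?_⟩
  rw [← smul_compress]
  exact hA.2.compress hs hα hβ

lemma FacLE.smul_real {n m : ℕ} {A : Matrix (Fin n) (Fin m) (↥S ⊗[ℂ] ↥T)} {r p : ℝ}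
    (hA : FacLE s1 t1 A r) (hp : 0 < p) : FacLE s1 t1 ((p : ℂ) • A) (p * r) := by
  refine ⟨mul_pos hp hA.1, ?_⟩
  have hp' : (p : ℂ) ≠ 0 := by exact_mod_cast hp.ne'
  rw [smul_smul, Complex.ofReal_mul, mul_inv_rev, mul_assoc, inv_mul_cancel₀ hp', mul_one]
  exact hA.2

lemma FacLE.blockDiagSum (hs : (s1 : H →L[ℂ] H) = 1) (ht : (t1 : K →L[ℂ] K) = 1)
    {n m p q : ℕ} {A : Matrix (Fin n) (Fin m) (↥S ⊗[ℂ] ↥T)}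
    {B : Matrix (Fin p) (Fin q) (↥S ⊗[ℂ] ↥T)} {r : ℝ}
    (hA : FacLE s1 t1 A r) (hB : FacLE s1 t1 B r) : FacLE s1 t1 (blockDiagSum A B) r := by
  refine ⟨hA.1, ?_⟩
  have h : (r : ℂ)⁻¹ • _root_.blockDiagSum A B =
      _root_.blockDiagSum ((r : ℂ)⁻¹ • A) ((r : ℂ)⁻¹ • B) :=
    blockDiagSum_map (f := fun v => (r : ℂ)⁻¹ • v) (smul_zero _) A B
  rw [h]
  exact hA.2.blockDiagSum hs ht hB.2

lemma FacLE.add (hs : (s1 : H →L[ℂ] H) = 1) (ht : (t1 : K →L[ℂ] K) = 1) {n m : ℕ}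
    {A B : Matrix (Fin n) (Fin m) (↥S ⊗[ℂ] ↥T)} {r s : ℝ}
    (hA : FacLE s1 t1 A r) (hB : FacLE s1 t1 B s) : FacLE s1 t1 (A + B) (r + s) := by
  have hrs : 0 < r + s := add_pos hA.1 hB.1
  have ha : √(r / (r + s)) ^ 2 = r / (r + s) := Real.sq_sqrt (div_nonneg hA.1.le hrs.le)
  have hb : √(s / (r + s)) ^ 2 = s / (r + s) := Real.sq_sqrt (div_nonneg hB.1.le hrs.le)
  have hab : √(r / (r + s)) ^ 2 + √(s / (r + s)) ^ 2 = 1 := by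
    rw [ha, hb, ← add_div, div_self hrs.ne']
  refine ⟨hrs, ?_⟩
  have key : ∀ {q : ℝ}, 0 < q → (√(q / (r + s)) : ℂ) * (√(q / (r + s)) : ℂ) * (q : ℂ)⁻¹ =
      ((r + s : ℝ) : ℂ)⁻¹ := fun {q} hq => by
    rw [← Complex.ofReal_mul, Real.mul_self_sqrt (div_nonneg hq.le hrs.le), ← Complex.ofReal_inv,
      ← Complex.ofReal_inv, ← Complex.ofReal_mul]
    congr 1
    field_simp
  have h := (hA.2.blockDiagSum hs ht hB.2).compress hs (cOpNorm_blockRow_smul_one_le n hab)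
    (cOpNorm_blockRow_transpose_smul_one_le m hab)
  rw [compress_blockDiagSum] at h
  simp only [Matrix.transpose_smul, Matrix.transpose_one, scalarMulMat_smul_one,
    matMulScalar_smul_one, smul_smul, ← mul_assoc] at h
  rwa [key hA.1, key hB.1, ← smul_add] at h

lemma facLE_zero {n m : ℕ} : FacLE s1 t1 (0 : Matrix (Fin n) (Fin m) (↥S ⊗[ℂ] ↥T)) 1 := by
  refine ⟨one_pos, ?_⟩
  rw [smul_zero]
  refine .single (Or.inl ⟨0, fun x => ?_, ?_⟩)
  · simpa using Finset.sum_nonneg fun i _ => sq_nonneg ‖x i‖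
  · ext i j
    exact (TensorProduct.zero_tmul _ _).symm

lemma single_map_comEmb {n m : ℕ} (i : Fin n) (j : Fin m) (x : ↥S ⊗[ℂ] ↥T) :
    (Matrix.single i j x).map (comEmb S T s1 t1) = Matrix.single i j (comEmb S T s1 t1 x) :=
  Matrix.map_single i j x (comEmbLin S T s1 t1)

lemma exists_facLE_single_tmul {n m : ℕ} (i : Fin n) (j : Fin m) (s : ↥S) (t : ↥T) :
    ∃ r, FacLE s1 t1 (Matrix.single i j (s ⊗ₜ[ℂ] t)) r := by
  obtain ⟨p, hp⟩ := exists_gt (subMatNorm (Matrix.single i j s))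
  obtain ⟨q, hq⟩ := exists_gt (subMatNorm (Matrix.single j j t))
  have hp0 : 0 < p := (opMatNorm_nonneg _).trans_lt hp
  have hq0 : 0 < q := (opMatNorm_nonneg _).trans_lt hq
  refine ⟨p * q, mul_pos hp0 hq0, ?_⟩
  have hM : IsFactor S T s1 t1 (Matrix.single i j (((p : ℂ)⁻¹ • s) ⊗ₜ[ℂ] t1)) := by
    refine Or.inl ⟨_, isContractive_inv_smul hp, ?_⟩
    rw [Matrix.smul_single]
    exact (Matrix.map_single i j _ ((TensorProduct.mk ℂ ↥S ↥T).flip t1)).symm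
  have hN : IsFactor S T s1 t1 (Matrix.single j j (s1 ⊗ₜ[ℂ] ((q : ℂ)⁻¹ • t))) := by
    refine Or.inr ⟨_, isContractive_inv_smul hq, ?_⟩
    rw [Matrix.smul_single]
    exact (Matrix.map_single j j _ (TensorProduct.mk ℂ ↥S ↥T s1)).symm
  have h := ContrFac.cons hM (.single hN)
  rw [single_map_comEmb, single_map_comEmb,
    Matrix.single_mul_single_same, comEmb_left_mul_right] at h
  rw [Matrix.smul_single, single_map_comEmb]
  rwa [← TensorProduct.smul_tmul', TensorProduct.tmul_smul, smul_smul, ← mul_inv,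
    ← Complex.ofReal_mul] at h

lemma exists_facLE (hs : (s1 : H →L[ℂ] H) = 1) (ht : (t1 : K →L[ℂ] K) = 1) {n m : ℕ}
    (A : Matrix (Fin n) (Fin m) (↥S ⊗[ℂ] ↥T)) : ∃ r, FacLE s1 t1 A r := by
  induction A using Matrix.induction_on' with
  | h_zero => exact ⟨1, facLE_zero⟩
  | h_add A B hA hB =>
    obtain ⟨r, hr⟩ := hA
    obtain ⟨s, hs'⟩ := hB
    exact ⟨r + s, hr.add hs ht hs'⟩
  | h_std_basis i j x =>
    induction x using TensorProduct.induction_on with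
    | zero => exact ⟨1, by rw [Matrix.single_zero]; exact facLE_zero⟩
    | tmul s t => exact exists_facLE_single_tmul i j s t
    | add x y hx hy =>
      obtain ⟨r, hr⟩ := hx
      obtain ⟨s, hs'⟩ := hy
      exact ⟨r + s, by rw [Matrix.single_add]; exact hr.add hs ht hs'⟩

variable (S T) in
/-- The action of `S ⊗ T` on the algebraic tensor product `H ⊗ K`. -/
def tensorAction : (↥S ⊗[ℂ] ↥T) →ₗ[ℂ] Module.End ℂ (H ⊗[ℂ] K) :=
  TensorProduct.homTensorHomMap (RingHom.id ℂ) H K H K ∘ₗ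
    TensorProduct.map (ContinuousLinearMap.coeLM ℂ ∘ₗ S.subtype)
      (ContinuousLinearMap.coeLM ℂ ∘ₗ T.subtype)

lemma tensorAction_tmul (s : ↥S) (t : ↥T) : tensorAction S T (s ⊗ₜ[ℂ] t) =
    TensorProduct.map (s : H →L[ℂ] H).toLinearMap (t : K →L[ℂ] K).toLinearMap := rfl

lemma tensorAction_left (ht : (t1 : K →L[ℂ] K) = 1) (s : ↥S) :
    tensorAction S T (s ⊗ₜ[ℂ] t1) = LinearMap.rTensor K (s : H →L[ℂ] H).toLinearMap := by
  rw [tensorAction_tmul, ht]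
  rfl

lemma tensorAction_right (hs : (s1 : H →L[ℂ] H) = 1) (t : ↥T) :
    tensorAction S T (s1 ⊗ₜ[ℂ] t) = LinearMap.lTensor H (t : K →L[ℂ] K).toLinearMap := by
  rw [tensorAction_tmul, hs]
  rfl

lemma tensorAction_injective : Function.Injective (tensorAction S T) := by
  rw [injective_iff_map_eq_zero]
  intro v hv
  let b := Module.Basis.ofVectorSpace ℂ ↥T
  obtain ⟨c, rfl⟩ := TensorProduct.eq_repr_basis_right b v
  suffices h : c = 0 by simp [h]
  ext1 k
  refine Subtype.ext (ContinuousLinearMap.ext fun x => ?_)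
  refine (Module.forall_dual_apply_eq_zero_iff ℂ _).1 fun φ => ?_
  have h : ∑ i ∈ c.support, φ ((c i : H →L[ℂ] H) x) • b i = 0 := by
    refine Subtype.ext (ContinuousLinearMap.ext fun y => ?_)
    have := congrArg (fun f => TensorProduct.lid ℂ K (LinearMap.rTensor K φ (f (x ⊗ₜ[ℂ] y)))) hv
    simpa [Finsupp.sum, tensorAction_tmul, LinearMap.sum_apply, sum_apply]
      using this
  by_cases hk : k ∈ c.support
  · exact linearIndependent_iff'.1 b.linearIndependent _ _ h k hk
  · simp [Finsupp.notMem_support_iff.1 hk]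

/-- The representation of `F_m(S ⊗ T)` on the algebraic tensor product `H ⊗ K`. -/
def comRep (hs : (s1 : H →L[ℂ] H) = 1) (ht : (t1 : K →L[ℂ] K) = 1) :
    ComFreeAlg S T s1 t1 →ₐ[ℂ] Module.End ℂ (H ⊗[ℂ] K) :=
  RingQuot.liftAlgHom ℂ ⟨TensorAlgebra.lift ℂ (tensorAction S T), by
    have h1 : tensorAction S T (s1 ⊗ₜ[ℂ] t1) = 1 := by
      rw [tensorAction_left ht, hs]
      exact LinearMap.rTensor_id K H
    rintro _ _ (⟨c, x, rfl, rfl⟩ | ⟨c, x, rfl, rfl⟩ | ⟨s, t, rfl, rfl⟩ | ⟨s, t, rfl, rfl⟩)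
    · simp [h1]
    · simp [h1]
    · rw [map_mul, TensorAlgebra.lift_ι_apply, TensorAlgebra.lift_ι_apply,
        TensorAlgebra.lift_ι_apply, tensorAction_left ht, tensorAction_right hs]
      exact LinearMap.rTensor_comp_lTensor _ _ _
    · rw [map_mul, TensorAlgebra.lift_ι_apply, TensorAlgebra.lift_ι_apply,
        TensorAlgebra.lift_ι_apply, tensorAction_left ht, tensorAction_right hs]
      exact LinearMap.lTensor_comp_rTensor _ _ _⟩

lemma comRep_comEmb (hs : (s1 : H →L[ℂ] H) = 1) (ht : (t1 : K →L[ℂ] K) = 1)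
    (v : ↥S ⊗[ℂ] ↥T) : comRep hs ht (comEmb S T s1 t1 v) = tensorAction S T v := by
  rw [comRep, comEmb, RingQuot.liftAlgHom_mkAlgHom_apply, TensorAlgebra.lift_ι_apply]

lemma IsFactor.sum_norm_sq_le (hs : (s1 : H →L[ℂ] H) = 1) (ht : (t1 : K →L[ℂ] K) = 1)
    {n m : ℕ} {M : Matrix (Fin n) (Fin m) (↥S ⊗[ℂ] ↥T)} (hM : IsFactor S T s1 t1 M)
    (u : Fin m → H ⊗[ℂ] K) :
    ∑ i, ‖∑ j, tensorAction S T (M i j) (u j)‖ ^ 2 ≤ ∑ j, ‖u j‖ ^ 2 := by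
  rcases hM with ⟨a, ha, rfl⟩ | ⟨a, ha, rfl⟩
  · simpa [tensorAction_left ht] using ha.rTensor u
  · simpa [tensorAction_right hs] using ha.lTensor u

lemma ContrFac.sum_norm_sq_le (hs : (s1 : H →L[ℂ] H) = 1) (ht : (t1 : K →L[ℂ] K) = 1)
    {n m : ℕ} {X : Matrix (Fin n) (Fin m) (ComFreeAlg S T s1 t1)} (hX : ContrFac S T s1 t1 X) :
    ∀ u : Fin m → H ⊗[ℂ] K, ∑ i, ‖∑ j, comRep hs ht (X i j) (u j)‖ ^ 2 ≤ ∑ j, ‖u j‖ ^ 2 := by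
  induction hX with
  | single hM => simpa [comRep_comEmb] using hM.sum_norm_sq_le hs ht
  | @cons n m k M hM X _ ih =>
    intro u
    refine le_trans (le_of_eq ?_)
      ((hM.sum_norm_sq_le hs ht fun l => ∑ j, comRep hs ht (X l j) (u j)).trans (ih u))
    refine Finset.sum_congr rfl fun i _ => ?_
    have : ∀ j, comRep hs ht ((M.map (comEmb S T s1 t1) * X) i j) (u j) =
        ∑ l, tensorAction S T (M i l) (comRep hs ht (X l j) (u j)) := fun j => by
      simp [Matrix.mul_apply, comRep_comEmb, LinearMap.sum_apply]
    simp_rw [this, map_sum]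
    rw [Finset.sum_comm]

lemma FacLE.norm_tensorAction_le (hs : (s1 : H →L[ℂ] H) = 1) (ht : (t1 : K →L[ℂ] K) = 1)
    {n m : ℕ} {A : Matrix (Fin n) (Fin m) (↥S ⊗[ℂ] ↥T)} {r : ℝ} (hA : FacLE s1 t1 A r)
    (i : Fin n) (j : Fin m) (w : H ⊗[ℂ] K) : ‖tensorAction S T (A i j) w‖ ≤ r * ‖w‖ := by
  have h := hA.2.sum_norm_sq_le hs ht (Pi.single j w)
  have h1 : ∀ i', ∑ j', comRep hs ht ((((r : ℂ)⁻¹ • A).map (comEmb S T s1 t1)) i' j')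
      ((Pi.single j w : Fin m → H ⊗[ℂ] K) j') = (r : ℂ)⁻¹ • tensorAction S T (A i' j) w := by
    intro i'
    rw [Finset.sum_eq_single j (fun j' _ hj => by simp [hj]) (by simp)]
    simp [comRep_comEmb]
  have h2 : ∑ j', ‖(Pi.single j w : Fin m → H ⊗[ℂ] K) j'‖ ^ 2 = ‖w‖ ^ 2 := by
    rw [Finset.sum_eq_single j (fun j' _ hj => by simp [hj]) (by simp)]
    simp
  simp_rw [h1, h2] at h
  have h3 := (Finset.single_le_sum (f := fun i' => ‖(r : ℂ)⁻¹ • tensorAction S T (A i' j) w‖ ^ 2)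
    (fun _ _ => sq_nonneg _) (Finset.mem_univ i)).trans h
  rw [sq_le_sq₀ (norm_nonneg _) (norm_nonneg _), norm_smul, norm_inv, Complex.norm_real,
    Real.norm_of_nonneg hA.1.le] at h3
  exact (inv_mul_le_iff₀ hA.1).1 h3

lemma comNorm_pos (hs : (s1 : H →L[ℂ] H) = 1) (ht : (t1 : K →L[ℂ] K) = 1) (hs0 : s1 ≠ 0)
    (ht0 : t1 ≠ 0) {n m : ℕ} {A : Matrix (Fin n) (Fin m) (↥S ⊗[ℂ] ↥T)} (hA : A ≠ 0) :
    0 < comNorm S T s1 t1 A := by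
  refine (comNorm_nonneg A).lt_of_ne' fun h0 => hA ?_
  ext i j
  refine tensorAction_injective ((LinearMap.ext fun w => ?_).trans (map_zero _).symm)
  rw [LinearMap.zero_apply, ← norm_le_zero_iff]
  have h : ∀ r : ℝ, 0 < r → ‖tensorAction S T (A i j) w‖ ≤ r * ‖w‖ := fun r hr =>
    (facLE_of_comNorm_lt hs0 ht0 (exists_facLE hs ht A) (h0.trans_lt hr)).norm_tensorAction_le
      hs ht i j w
  have hc : Filter.Tendsto (fun r : ℝ => r * ‖w‖) (nhdsWithin 0 (Set.Ioi 0)) (nhds 0) :=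
    ((by fun_prop : Continuous fun r : ℝ => r * ‖w‖).tendsto' 0 0 (by simp)).mono_left
      nhdsWithin_le_nhds
  exact ge_of_tendsto hc (Filter.eventually_of_mem self_mem_nhdsWithin h)

lemma cOpNorm_inv_smul_le {n k : ℕ} {α : Matrix (Fin n) (Fin k) ℂ} {p : ℝ} (h : cOpNorm α < p) :
    cOpNorm ((p : ℂ)⁻¹ • α) ≤ 1 := by
  have hp : 0 < p := (cOpNorm_nonneg _).trans_lt h
  rw [cOpNorm_smul, norm_inv, Complex.norm_real, Real.norm_of_nonneg hp.le, inv_mul_le_one₀ hp]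
  exact h.le

lemma comNorm_compress_le (hs : (s1 : H →L[ℂ] H) = 1) (ht : (t1 : K →L[ℂ] K) = 1) (hs0 : s1 ≠ 0)
    (ht0 : t1 ≠ 0) {n m k l : ℕ} (A : Matrix (Fin n) (Fin m) (↥S ⊗[ℂ] ↥T))
    (α : Matrix (Fin k) (Fin n) ℂ) (β : Matrix (Fin m) (Fin l) ℂ) :
    comNorm S T s1 t1 (matMulScalar (scalarMulMat α A) β) ≤
      cOpNorm α * cOpNorm β * comNorm S T s1 t1 A := by
  have h : ∀ ε : ℝ, 0 < ε → comNorm S T s1 t1 (matMulScalar (scalarMulMat α A) β) ≤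
      (cOpNorm α + ε) * (cOpNorm β + ε) * (comNorm S T s1 t1 A + ε) := fun ε hε => by
    have hp : 0 < cOpNorm α + ε := add_pos_of_nonneg_of_pos (cOpNorm_nonneg _) hε
    have hq : 0 < cOpNorm β + ε := add_pos_of_nonneg_of_pos (cOpNorm_nonneg _) hε
    have hA := facLE_of_comNorm_lt hs0 ht0 (exists_facLE hs ht A) (lt_add_of_pos_right _ hε)
    have hc := (hA.compress hs (cOpNorm_inv_smul_le (lt_add_of_pos_right (cOpNorm α) hε))
      (cOpNorm_inv_smul_le (lt_add_of_pos_right (cOpNorm β) hε))).smul_real (mul_pos hp hq)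
    have hp' : ((cOpNorm α + ε : ℝ) : ℂ) ≠ 0 := by exact_mod_cast hp.ne'
    have hq' : ((cOpNorm β + ε : ℝ) : ℂ) ≠ 0 := by exact_mod_cast hq.ne'
    have e : (((cOpNorm α + ε) * (cOpNorm β + ε) : ℝ) : ℂ) • matMulScalar
        (scalarMulMat (((cOpNorm α + ε : ℝ) : ℂ)⁻¹ • α) A) (((cOpNorm β + ε : ℝ) : ℂ)⁻¹ • β) =
        matMulScalar (scalarMulMat α A) β := by
      generalize cOpNorm α + ε = p at hp'
      generalize cOpNorm β + ε = q at hq'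
      ext i j
      simp only [matMulScalar, scalarMulMat, Matrix.smul_apply, Matrix.of_apply, Finset.smul_sum,
        smul_smul, smul_eq_mul]
      refine Finset.sum_congr rfl fun x _ => Finset.sum_congr rfl fun y _ => ?_
      congr 1
      push_cast
      field_simp
    rw [e] at hc
    exact hc.comNorm_le hs0 ht0
  have hc : Filter.Tendsto
      (fun ε : ℝ => (cOpNorm α + ε) * (cOpNorm β + ε) * (comNorm S T s1 t1 A + ε))
      (nhdsWithin 0 (Set.Ioi 0)) (nhds (cOpNorm α * cOpNorm β * comNorm S T s1 t1 A)) :=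
    (Continuous.tendsto' (by fun_prop) 0 _ (by simp)).mono_left nhdsWithin_le_nhds
  exact ge_of_tendsto hc (Filter.eventually_of_mem self_mem_nhdsWithin h)

lemma comNorm_smul_le (hs : (s1 : H →L[ℂ] H) = 1) (ht : (t1 : K →L[ℂ] K) = 1) (hs0 : s1 ≠ 0)
    (ht0 : t1 ≠ 0) {n m : ℕ} (c : ℂ) (A : Matrix (Fin n) (Fin m) (↥S ⊗[ℂ] ↥T)) :
    comNorm S T s1 t1 (c • A) ≤ ‖c‖ * comNorm S T s1 t1 A := by
  have h := comNorm_compress_le hs ht hs0 ht0 A (c • (1 : Matrix (Fin n) (Fin n) ℂ))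
    (1 : Matrix (Fin m) (Fin m) ℂ)
  rw [matMulScalar_one, scalarMulMat_smul_one, cOpNorm_smul] at h
  refine h.trans (mul_le_mul_of_nonneg_right ?_ (comNorm_nonneg A))
  calc ‖c‖ * cOpNorm 1 * cOpNorm 1 ≤ ‖c‖ * 1 * 1 := by
        gcongr
        · exact cOpNorm_nonneg _
        · exact cOpNorm_one_le n
        · exact cOpNorm_one_le m
    _ = ‖c‖ := by ring

lemma comNorm_smul (hs : (s1 : H →L[ℂ] H) = 1) (ht : (t1 : K →L[ℂ] K) = 1) (hs0 : s1 ≠ 0)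
    (ht0 : t1 ≠ 0) {n m : ℕ} (c : ℂ) (A : Matrix (Fin n) (Fin m) (↥S ⊗[ℂ] ↥T)) :
    comNorm S T s1 t1 (c • A) = ‖c‖ * comNorm S T s1 t1 A := by
  refine le_antisymm (comNorm_smul_le hs ht hs0 ht0 c A) ?_
  rcases eq_or_ne c 0 with rfl | hc
  · simpa using comNorm_nonneg _
  · have h := comNorm_smul_le hs ht hs0 ht0 c⁻¹ (c • A)
    rwa [inv_smul_smul₀ hc, norm_inv, le_inv_mul_iff₀ (norm_pos_iff.2 hc)] at h

lemma comNorm_add_le (hs : (s1 : H →L[ℂ] H) = 1) (ht : (t1 : K →L[ℂ] K) = 1) (hs0 : s1 ≠ 0)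
    (ht0 : t1 ≠ 0) {n m : ℕ} (A B : Matrix (Fin n) (Fin m) (↥S ⊗[ℂ] ↥T)) :
    comNorm S T s1 t1 (A + B) ≤ comNorm S T s1 t1 A + comNorm S T s1 t1 B := by
  refine le_of_forall_pos_le_add fun ε hε => ?_
  have hA := facLE_of_comNorm_lt hs0 ht0 (exists_facLE hs ht A)
    (lt_add_of_pos_right _ (half_pos hε))
  have hB := facLE_of_comNorm_lt hs0 ht0 (exists_facLE hs ht B)
    (lt_add_of_pos_right _ (half_pos hε))
  refine ((hA.add hs ht hB).comNorm_le hs0 ht0).trans_eq ?_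
  ring

lemma comNorm_compress_le_of_le_one (hs : (s1 : H →L[ℂ] H) = 1) (ht : (t1 : K →L[ℂ] K) = 1)
    (hs0 : s1 ≠ 0) (ht0 : t1 ≠ 0) {n m k l : ℕ} (A : Matrix (Fin n) (Fin m) (↥S ⊗[ℂ] ↥T))
    {α : Matrix (Fin k) (Fin n) ℂ} {β : Matrix (Fin m) (Fin l) ℂ}
    (hα : cOpNorm α ≤ 1) (hβ : cOpNorm β ≤ 1) :
    comNorm S T s1 t1 (matMulScalar (scalarMulMat α A) β) ≤ comNorm S T s1 t1 A :=
  (comNorm_compress_le hs ht hs0 ht0 A α β).trans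
    (mul_le_of_le_one_left (comNorm_nonneg A) (mul_le_one₀ hα (cOpNorm_nonneg _) hβ))

lemma comNorm_blockDiagSum (hs : (s1 : H →L[ℂ] H) = 1) (ht : (t1 : K →L[ℂ] K) = 1) (hs0 : s1 ≠ 0)
    (ht0 : t1 ≠ 0) {n m p q : ℕ} (A : Matrix (Fin n) (Fin m) (↥S ⊗[ℂ] ↥T))
    (B : Matrix (Fin p) (Fin q) (↥S ⊗[ℂ] ↥T)) :
    comNorm S T s1 t1 (blockDiagSum A B) = max (comNorm S T s1 t1 A) (comNorm S T s1 t1 B) := by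
  refine le_antisymm (le_of_forall_gt_imp_ge_of_dense fun r hr => ?_) (max_le ?_ ?_)
  · obtain ⟨hA, hB⟩ := max_lt_iff.1 hr
    exact ((facLE_of_comNorm_lt hs0 ht0 (exists_facLE hs ht A) hA).blockDiagSum hs ht
      (facLE_of_comNorm_lt hs0 ht0 (exists_facLE hs ht B) hB)).comNorm_le hs0 ht0
  · have h := comNorm_compress_le_of_le_one hs ht hs0 ht0 (blockDiagSum A B)
      (cOpNorm_blockRow_one_zero_le n p) (cOpNorm_blockRow_transpose_one_zero_le m q)
    simpa [compress_blockDiagSum, scalarMulMat_one, matMulScalar_one, matMulScalar_zero] using h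
  · have h := comNorm_compress_le_of_le_one hs ht hs0 ht0 (blockDiagSum A B)
      (cOpNorm_blockRow_zero_one_le n p) (cOpNorm_blockRow_transpose_zero_one_le m q)
    simpa [compress_blockDiagSum, scalarMulMat_one, matMulScalar_one, matMulScalar_zero] using h

end MatrixNorm

/-- **The factorization norms of the commuting partial product form an `L^∞`-matrix norm.**
Let `S ⊆ B(H)` and `T ⊆ B(K)` be operator systems.  Then the factorization quantities
`‖·‖ᶜ` on matrices over the algebraic tensor product `S ⊗ T` are norms (homogeneous,
subadditive, and positive on nonzero matrices), are compatible with scalar matrix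
multiplication, and are multiplicative on direct sums. -/
theorem comNorm_is_matrix_norm
    (hS1 : (1 : H →L[ℂ] H) ∈ S) (hT1 : (1 : K →L[ℂ] K) ∈ T)
    (hSstar : ∀ a : H →L[ℂ] H, a ∈ S → star a ∈ S)
    (hTstar : ∀ a : K →L[ℂ] K, a ∈ T → star a ∈ T) :
    (∀ (n : ℕ) (c : ℂ) (A : Matrix (Fin n) (Fin n) (↥S ⊗[ℂ] ↥T)),
        comNorm S T ⟨1, hS1⟩ ⟨1, hT1⟩ (c • A) = ‖c‖ * comNorm S T ⟨1, hS1⟩ ⟨1, hT1⟩ A) ∧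
    (∀ (n : ℕ) (A B : Matrix (Fin n) (Fin n) (↥S ⊗[ℂ] ↥T)),
        comNorm S T ⟨1, hS1⟩ ⟨1, hT1⟩ (A + B) ≤
          comNorm S T ⟨1, hS1⟩ ⟨1, hT1⟩ A + comNorm S T ⟨1, hS1⟩ ⟨1, hT1⟩ B) ∧
    (∀ (n : ℕ) (A : Matrix (Fin n) (Fin n) (↥S ⊗[ℂ] ↥T)),
        A ≠ 0 → 0 < comNorm S T ⟨1, hS1⟩ ⟨1, hT1⟩ A) ∧
    (∀ (n k : ℕ) (A : Matrix (Fin n) (Fin n) (↥S ⊗[ℂ] ↥T))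
        (α : Matrix (Fin k) (Fin n) ℂ) (β : Matrix (Fin n) (Fin k) ℂ),
        comNorm S T ⟨1, hS1⟩ ⟨1, hT1⟩ (matMulScalar (scalarMulMat α A) β) ≤
          cOpNorm α * cOpNorm β * comNorm S T ⟨1, hS1⟩ ⟨1, hT1⟩ A) ∧
    (∀ (n k : ℕ) (A : Matrix (Fin n) (Fin n) (↥S ⊗[ℂ] ↥T))
        (B : Matrix (Fin k) (Fin k) (↥S ⊗[ℂ] ↥T)),
        comNorm S T ⟨1, hS1⟩ ⟨1, hT1⟩ (blockDiagSum A B) =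
          max (comNorm S T ⟨1, hS1⟩ ⟨1, hT1⟩ A) (comNorm S T ⟨1, hS1⟩ ⟨1, hT1⟩ B)) := by
  by_cases hHK : Subsingleton H ∨ Subsingleton K
  · have h0 : ∀ {n k : ℕ} (A : Matrix (Fin n) (Fin k) (↥S ⊗[ℂ] ↥T)),
        comNorm S T ⟨1, hS1⟩ ⟨1, hT1⟩ A = 0 := comNorm_eq_zero_of_subsingleton hHK
    have : Subsingleton (↥S ⊗[ℂ] ↥T) := by
      rcases hHK with h | h <;> infer_instance
    simp only [h0]
    exact ⟨by simp, by simp, fun n A hA => absurd (Subsingleton.elim A 0) hA, by simp, by simp⟩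
  · rw [not_or, not_subsingleton_iff_nontrivial, not_subsingleton_iff_nontrivial] at hHK
    obtain ⟨_, _⟩ := hHK
    have hs0 : (⟨1, hS1⟩ : ↥S) ≠ 0 := fun h => one_ne_zero (congrArg Subtype.val h)
    have ht0 : (⟨1, hT1⟩ : ↥T) ≠ 0 := fun h => one_ne_zero (congrArg Subtype.val h)
    exact ⟨fun _ => comNorm_smul rfl rfl hs0 ht0, fun _ => comNorm_add_le rfl rfl hs0 ht0,
      fun _ _ => comNorm_pos rfl rfl hs0 ht0,
      fun _ _ => comNorm_compress_le rfl rfl hs0 ht0,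
      fun _ _ => comNorm_blockDiagSum rfl rfl hs0 ht0⟩
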